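/- Let μ₁,…,μ_k be distinct real numbers, let V₁,…,V_k be nonzero finite-dimensional ℂ-subspaces of ℂ[x], set N = Σ_j dim V_j, and let q₁,…,q_N : ℝ → ℂ be a basis of the ℂ-vector space W of functions x ↦ Σ_{j=1}^k e^{μ_j x} p_j(x) with p_j ∈ V_j. Suppose there exists a nonzero polynomial P ∈ ℂ[x] all of whose complex roots are real such that Wr(q₁,…,q_N)(x) = e^{(Σ_j (dim V_j)·μ_j)·x} · P(x) for all x ∈ ℝ. Then each of the subspaces V₁,…,V_k has a real basis. -/

import Mathlib

section

open Equiv Polynomial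

/-- A finite commuting family of endomorphisms has a common eigenvector. -/
theorem exists_common_eigenvector {ι V : Type*} [Fintype ι] [AddCommGroup V] [Module ℂ V]
    [FiniteDimensional ℂ V] [Nontrivial V] (f : ι → Module.End ℂ V)
    (hf : ∀ i j, Commute (f i) (f j)) :
    ∃ (ν : ι → ℂ) (v : V), v ≠ 0 ∧ ∀ i, f i v = ν i • v := by
  classical
  suffices h : ∀ s : Finset ι, ∃ (ν : ι → ℂ) (v : V), v ≠ 0 ∧ ∀ i ∈ s, f i v = ν i • v by
    obtain ⟨ν, v, hv, h⟩ := h Finset.univ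
    exact ⟨ν, v, hv, fun i => h i (Finset.mem_univ i)⟩
  intro s
  induction s using Finset.induction_on with
  | empty =>
    obtain ⟨v, hv⟩ := exists_ne (0 : V)
    exact ⟨0, v, hv, by simp⟩
  | insert a s ha ih =>
    obtain ⟨ν, v, hv, h⟩ := ih
    let W : Submodule ℂ V := ⨅ i ∈ s, (f i).eigenspace (ν i)
    have hW : ∀ w, w ∈ W ↔ ∀ i ∈ s, f i w = ν i • w := by
      intro w
      simp [W, Submodule.mem_iInf]
    have hmaps : ∀ w ∈ W, f a w ∈ W := by
      intro w hw
      rw [hW] at hw ⊢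
      intro i hi
      have := LinearMap.congr_fun (hf i a).eq w
      simp only [Module.End.mul_apply] at this
      rw [this, hw i hi, map_smul]
    have hvW : v ∈ W := (hW v).2 h
    have : Nontrivial W := ⟨⟨⟨v, hvW⟩, 0, fun h => hv (by simpa using congrArg Subtype.val h)⟩⟩
    obtain ⟨c, hc⟩ := Module.End.exists_eigenvalue ((f a).restrict hmaps)
    obtain ⟨w, hw⟩ := hc.exists_hasEigenvector
    have hw1 := hw.apply_eq_smul
    refine ⟨Function.update ν a c, w, fun h => hw.2 (Subtype.ext h), fun i hi => ?_⟩
    rcases Finset.mem_insert.1 hi with rfl | hi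
    · simpa using congrArg Subtype.val hw1
    · have : i ≠ a := fun h => ha (h ▸ hi)
      simpa [this] using (hW w).1 w.2 i hi

namespace Cherednik

section Relations

variable {n : ℕ} {A : Type*} [Ring A] (s : Perm (Fin n) →* A) (x y : Fin n → A)
  (hy : ∀ i j, Commute (y i) (y j))

/-- The product of the commuting elements `y i` over `i ∈ T`. -/
def prodOver (T : Finset (Fin n)) : A :=
  T.noncommProd y fun i _ j _ _ => hy i j

theorem prodOver_empty : prodOver y hy ∅ = 1 :=
  Finset.noncommProd_empty _ _

theorem prodOver_insert {T : Finset (Fin n)} {a : Fin n} (ha : a ∉ T) :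
    prodOver y hy (insert a T) = y a * prodOver y hy T :=
  Finset.noncommProd_insert_of_notMem _ _ _ _ ha

theorem mul_prodOver_erase {T : Finset (Fin n)} {a : Fin n} (ha : a ∈ T) :
    y a * prodOver y hy (T.erase a) = prodOver y hy T := by
  rw [← prodOver_insert y hy (Finset.notMem_erase a T), Finset.insert_erase ha]

theorem commute_prodOver (a : Fin n) (T : Finset (Fin n)) :
    Commute (y a) (prodOver y hy T) :=
  Finset.noncommProd_commute _ _ _ _ fun i _ => hy a i

variable (hs : ∀ (σ : Perm (Fin n)) i, s σ * y i = y (σ i) * s σ)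

include hs in
theorem map_mul_prodOver (σ : Perm (Fin n)) (T : Finset (Fin n)) :
    s σ * prodOver y hy T = prodOver y hy (T.map σ.toEmbedding) * s σ := by
  induction T using Finset.induction_on with
  | empty => simp [prodOver_empty]
  | insert a T ha ih =>
    rw [Finset.map_insert, prodOver_insert y hy ha, prodOver_insert, mul_assoc, ← ih, ← mul_assoc,
      hs, mul_assoc]
    · rfl
    · simpa using ha

include hs in
theorem commute_map_prodOver (σ : Perm (Fin n)) (T : Finset (Fin n)) (h : ∀ i ∈ T, σ i = i) :
    Commute (s σ) (prodOver y hy T) := by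
  have hT : T.map σ.toEmbedding = T := by
    have : ∀ i ∈ T, σ.symm i = i := fun i hi => by rw [Equiv.symm_apply_eq, h i hi]
    ext i
    simp only [Finset.mem_map_equiv]
    constructor
    · intro hi
      have := h _ hi
      rw [Equiv.apply_symm_apply] at this
      rwa [this]
    · intro hi
      rwa [this i hi]
  have := map_mul_prodOver s y hy hs σ T
  rwa [hT] at this

variable (h₁ : ∀ i j, i ≠ j → y i * x j = x j * y i + s (swap i j))
  (h₂ : ∀ i, y i * x i = x i * y i - ∑ k ∈ Finset.univ.erase i, s (swap i k))

include hs h₁ in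
theorem prodOver_mul_of_notMem (j : Fin n) (T : Finset (Fin n)) (hj : j ∉ T) :
    prodOver y hy T * x j =
      x j * prodOver y hy T + ∑ i ∈ T, s (swap i j) * prodOver y hy (T.erase i) := by
  induction T using Finset.induction_on with
  | empty => simp [prodOver_empty]
  | insert a T ha ih =>
    simp only [Finset.mem_insert, not_or] at hj
    rw [prodOver_insert y hy ha, mul_assoc, ih hj.2, Finset.sum_insert ha, Finset.erase_insert ha,
      mul_add, ← mul_assoc, h₁ a j (Ne.symm hj.1), Finset.mul_sum, add_mul, mul_assoc, add_assoc]
    congr 2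
    refine Finset.sum_congr rfl fun i hi => ?_
    have hia : i ≠ a := fun h => ha (h ▸ hi)
    have h3 := hs (swap i j) a
    rw [swap_apply_of_ne_of_ne hia.symm (Ne.symm hj.1)] at h3
    rw [← mul_assoc, ← h3, mul_assoc, Finset.erase_insert_of_ne hia.symm,
      prodOver_insert y hy (fun h => ha (Finset.mem_of_mem_erase h))]

include hs h₁ h₂ in
theorem prodOver_mul_of_mem (j : Fin n) (T : Finset (Fin n)) (hj : j ∈ T) :
    prodOver y hy T * x j =
      x j * prodOver y hy T - ∑ l ∈ Tᶜ, s (swap j l) * prodOver y hy (T.erase j) := by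
  set T' := T.erase j with hT'
  have hjT : j ∉ T' := Finset.notMem_erase j T
  have e1 : prodOver y hy T = y j * prodOver y hy T' := (mul_prodOver_erase y hy hj).symm
  have e2 : Finset.univ.erase j = T' ∪ Tᶜ := by
    ext i
    simp only [Finset.mem_erase, Finset.mem_univ, and_true, hT', Finset.mem_union,
      Finset.mem_compl]
    by_cases hi : i ∈ T
    · simp [hi]
    · simp only [hi, and_false, not_false_eq_true, or_true, iff_true]
      exact fun h => hi (h ▸ hj)
  have e3 : Disjoint T' Tᶜ :=
    Finset.disjoint_left.2 fun i hi h => Finset.mem_compl.1 h (Finset.mem_of_mem_erase hi)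
  have e4 : ∑ i ∈ T', y j * (s (swap i j) * prodOver y hy (T'.erase i)) =
      ∑ i ∈ T', s (swap j i) * prodOver y hy T' := by
    refine Finset.sum_congr rfl fun i hi => ?_
    have h3 := hs (swap i j) i
    rw [swap_apply_left] at h3
    rw [← mul_assoc, ← h3, mul_assoc, mul_prodOver_erase y hy hi, swap_comm]
  rw [e1, mul_assoc, prodOver_mul_of_notMem s x y hy hs h₁ j T' hjT, mul_add, ← mul_assoc, h₂, e2,
    Finset.sum_union e3, Finset.mul_sum, e4, sub_mul, add_mul, Finset.sum_mul, Finset.sum_mul,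
    mul_assoc]
  abel

end Relations

section Antisymmetrizer

variable {n : ℕ}

/-- The coefficient `(-1)^(n - |T|) sgn(σ) ∏_{i ∈ T} (x - a i)`. -/
noncomputable def coef (x : ℂ) (a : Fin n → ℂ) (T : Finset (Fin n)) (σ : Perm (Fin n)) : ℂ :=
  (-1) ^ Tᶜ.card * ((Perm.sign σ : ℤ) : ℂ) * ∏ i ∈ T, (x - a i)

theorem coef_insert (x : ℂ) (a : Fin n → ℂ) {T : Finset (Fin n)} {i j k : Fin n} (hi : i ∉ T)
    (hjk : j ≠ k) (σ : Perm (Fin n)) :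
    coef x a (insert i T) (σ * swap j k) = (x - a i) * coef x a T σ := by
  have hc : Tᶜ.card = (insert i T)ᶜ.card + 1 := by
    rw [Finset.compl_insert, Finset.card_erase_add_one (Finset.mem_compl.2 hi)]
  rw [coef, coef, hc, Finset.prod_insert hi, Perm.sign_mul, Perm.sign_swap hjk, pow_succ]
  push_cast
  ring

theorem sum_insert_image (x : ℂ) (a : Fin n → ℂ) (j : Fin n)
    (F : Finset (Fin n) → Perm (Fin n) → ℂ) :
    ∑ q : (Finset (Fin n) × Perm (Fin n)) × Fin n with
        (∀ i ∈ q.1.1, q.1.2 i = i) ∧ j ∉ q.1.1 ∧ q.2 ∈ q.1.1,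
        coef x a q.1.1 q.1.2 * F (q.1.1.erase q.2) (q.1.2 * swap q.2 j) =
      ∑ q : Finset (Fin n) × Perm (Fin n) with (∀ i ∈ q.1, q.2 i = i) ∧ j ∉ q.1 ∧ q.2 j ≠ j,
        (x - a (q.2 j)) * coef x a q.1 q.2 * F q.1 q.2 := by
  refine Finset.sum_bij' (fun q _ => (q.1.1.erase q.2, q.1.2 * swap q.2 j))
    (fun q _ => ((insert (q.2 j) q.1, q.2 * swap (q.2 j) j), q.2 j)) ?_ ?_ ?_ ?_ ?_
  · rintro ⟨⟨T, σ⟩, i⟩ hq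
    simp only [Finset.mem_filter, Finset.mem_univ, true_and] at hq ⊢
    obtain ⟨h1, h2, h3⟩ := hq
    have hij : i ≠ j := fun h => h2 (h ▸ h3)
    refine ⟨fun k hk => ?_, fun h => h2 (Finset.mem_of_mem_erase h), ?_⟩
    · obtain ⟨hki, hkT⟩ := Finset.mem_erase.1 hk
      have hkj : k ≠ j := fun h => h2 (h ▸ hkT)
      rw [Perm.mul_apply, swap_apply_of_ne_of_ne hki hkj, h1 k hkT]
    · rw [Perm.mul_apply, swap_apply_right, h1 i h3]
      exact hij
  · rintro ⟨T, τ⟩ hq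
    simp only [Finset.mem_filter, Finset.mem_univ, true_and] at hq ⊢
    obtain ⟨h1, h2, h3⟩ := hq
    have hT : τ j ∉ T := fun h => h3 (τ.injective (h1 _ h))
    refine ⟨fun k hk => ?_, ?_, Finset.mem_insert_self _ _⟩
    · rcases Finset.mem_insert.1 hk with rfl | hk
      · rw [Perm.mul_apply, swap_apply_left]
      · rw [Perm.mul_apply, swap_apply_of_ne_of_ne (ne_of_mem_of_not_mem hk hT)
          (ne_of_mem_of_not_mem hk h2),
          h1 k hk]
    · rw [Finset.mem_insert, not_or]
      exact ⟨Ne.symm h3, h2⟩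
  · rintro ⟨⟨T, σ⟩, i⟩ hq
    simp only [Finset.mem_filter, Finset.mem_univ, true_and] at hq ⊢
    obtain ⟨h1, h2, h3⟩ := hq
    have : (σ * swap i j) j = i := by rw [Perm.mul_apply, swap_apply_right, h1 i h3]
    rw [this, Finset.insert_erase h3, mul_assoc, swap_mul_self, mul_one]
  · rintro ⟨T, τ⟩ hq
    simp only [Finset.mem_filter, Finset.mem_univ, true_and] at hq ⊢
    obtain ⟨h1, h2, h3⟩ := hq
    have hT : τ j ∉ T := fun h => h3 (τ.injective (h1 _ h))
    rw [Finset.erase_insert hT, mul_assoc, swap_mul_self, mul_one]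
  · rintro ⟨⟨T, σ⟩, i⟩ hq
    simp only [Finset.mem_filter, Finset.mem_univ, true_and] at hq ⊢
    obtain ⟨h1, h2, h3⟩ := hq
    have hij : i ≠ j := fun h => h2 (h ▸ h3)
    have h4 : (σ * swap i j) j = i := by rw [Perm.mul_apply, swap_apply_right, h1 i h3]
    have := coef_insert x a (Finset.notMem_erase i T) hij (σ * swap i j)
    rw [Finset.insert_erase h3, mul_assoc, swap_mul_self, mul_one] at this
    rw [h4, this]

theorem sum_insert_point (x : ℂ) (a : Fin n → ℂ) (j : Fin n)
    (F : Finset (Fin n) → Perm (Fin n) → ℂ) :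
    ∑ q : (Finset (Fin n) × Perm (Fin n)) × Fin n with
        (∀ i ∈ q.1.1, q.1.2 i = i) ∧ j ∈ q.1.1 ∧ q.2 ∉ q.1.1,
        coef x a q.1.1 q.1.2 * F (q.1.1.erase j) (q.1.2 * swap j q.2) =
      ∑ q : Finset (Fin n) × Perm (Fin n) with (∀ i ∈ q.1, q.2 i = i) ∧ j ∉ q.1 ∧ q.2 j ≠ j,
        (x - a j) * coef x a q.1 q.2 * F q.1 q.2 := by
  refine Finset.sum_bij' (fun q _ => (q.1.1.erase j, q.1.2 * swap j q.2))
    (fun q _ => ((insert j q.1, q.2 * swap j (q.2.symm j)), q.2.symm j)) ?_ ?_ ?_ ?_ ?_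
  · rintro ⟨⟨T, σ⟩, l⟩ hq
    simp only [Finset.mem_filter, Finset.mem_univ, true_and] at hq ⊢
    obtain ⟨h1, h2, h3⟩ := hq
    have hlj : l ≠ j := fun h => h3 (h ▸ h2)
    refine ⟨fun k hk => ?_, Finset.notMem_erase _ _, ?_⟩
    · obtain ⟨hkj, hkT⟩ := Finset.mem_erase.1 hk
      have hkl : k ≠ l := fun h => h3 (h ▸ hkT)
      rw [Perm.mul_apply, swap_apply_of_ne_of_ne hkj hkl, h1 k hkT]
    · rw [Perm.mul_apply, swap_apply_left]
      intro h
      exact hlj (σ.injective (h.trans (h1 j h2).symm))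
  · rintro ⟨T, τ⟩ hq
    simp only [Finset.mem_filter, Finset.mem_univ, true_and] at hq ⊢
    obtain ⟨h1, h2, h3⟩ := hq
    have hl : τ.symm j ∉ T := fun h => h2 (by have := h1 _ h; rw [Equiv.apply_symm_apply] at this
                                              rwa [← this] at h)
    have hlj : τ.symm j ≠ j := fun h => h3 ((Equiv.symm_apply_eq τ).1 h).symm
    refine ⟨fun k hk => ?_, Finset.mem_insert_self _ _, ?_⟩
    · rcases Finset.mem_insert.1 hk with rfl | hk
      · rw [Perm.mul_apply, swap_apply_left, Equiv.apply_symm_apply]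
      · rw [Perm.mul_apply, swap_apply_of_ne_of_ne (ne_of_mem_of_not_mem hk h2)
          (ne_of_mem_of_not_mem hk hl),
          h1 k hk]
    · rw [Finset.mem_insert, not_or]
      exact ⟨hlj, hl⟩
  · rintro ⟨⟨T, σ⟩, l⟩ hq
    simp only [Finset.mem_filter, Finset.mem_univ, true_and] at hq ⊢
    obtain ⟨h1, h2, h3⟩ := hq
    have : (σ * swap j l).symm j = l := by
      rw [Equiv.symm_apply_eq, Perm.mul_apply, swap_apply_right, h1 j h2]
    rw [this, Finset.insert_erase h2, mul_assoc, swap_mul_self, mul_one]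
  · rintro ⟨T, τ⟩ hq
    simp only [Finset.mem_filter, Finset.mem_univ, true_and] at hq ⊢
    rw [Finset.erase_insert hq.2.1, mul_assoc, swap_mul_self, mul_one]
  · rintro ⟨⟨T, σ⟩, l⟩ hq
    simp only [Finset.mem_filter, Finset.mem_univ, true_and] at hq ⊢
    obtain ⟨h1, h2, h3⟩ := hq
    have hlj : j ≠ l := fun h => h3 (h ▸ h2)
    have := coef_insert x a (Finset.notMem_erase j T) hlj (σ * swap j l)
    rw [Finset.insert_erase h2, mul_assoc, swap_mul_self, mul_one] at this
    rw [this]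

/-- The cancellation which makes the antisymmetrized sum below commute with the coordinates. -/
theorem antisymmetrizer_identity (x : ℂ) (a : Fin n → ℂ) (j : Fin n)
    (F : Finset (Fin n) → Perm (Fin n) → ℂ) :
    ∑ q : Finset (Fin n) × Perm (Fin n) with (∀ i ∈ q.1, q.2 i = i),
      coef x a q.1 q.2 * ((a (q.2 j) - a j) * F q.1 q.2 +
        if j ∈ q.1 then -∑ l ∈ q.1ᶜ, F (q.1.erase j) (q.2 * swap j l)
        else ∑ i ∈ q.1, F (q.1.erase i) (q.2 * swap i j)) = 0 := by
  have h1 : ∑ q : Finset (Fin n) × Perm (Fin n) with (∀ i ∈ q.1, q.2 i = i),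
      coef x a q.1 q.2 * ((a (q.2 j) - a j) * F q.1 q.2) =
      ∑ q : Finset (Fin n) × Perm (Fin n) with (∀ i ∈ q.1, q.2 i = i) ∧ j ∉ q.1 ∧ q.2 j ≠ j,
      (a (q.2 j) - a j) * coef x a q.1 q.2 * F q.1 q.2 := by
    rw [← Finset.filter_filter, Finset.sum_filter
      (fun q : Finset (Fin n) × Perm (Fin n) => j ∉ q.1 ∧ q.2 j ≠ j)]
    refine Finset.sum_congr rfl fun q hq => ?_
    simp only [Finset.mem_filter, Finset.mem_univ, true_and] at hq
    split_ifs with h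
    · ring
    · have : q.2 j = j := by
        by_contra h3
        exact h ⟨fun h4 => h3 (hq j h4), h3⟩
      rw [this]
      ring
  have h2 : ∑ q : Finset (Fin n) × Perm (Fin n) with (∀ i ∈ q.1, q.2 i = i),
      coef x a q.1 q.2 * (if j ∈ q.1 then 0 else ∑ i ∈ q.1, F (q.1.erase i) (q.2 * swap i j)) =
      ∑ q : (Finset (Fin n) × Perm (Fin n)) × Fin n with
        (∀ i ∈ q.1.1, q.1.2 i = i) ∧ j ∉ q.1.1 ∧ q.2 ∈ q.1.1,
        coef x a q.1.1 q.1.2 * F (q.1.1.erase q.2) (q.1.2 * swap q.2 j) := by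
    rw [Finset.sum_filter, Finset.sum_filter,
      Fintype.sum_prod_type (α₁ := Finset (Fin n) × Perm (Fin n)) (α₂ := Fin n)]
    refine Finset.sum_congr rfl fun q _ => ?_
    by_cases hq : ∀ i ∈ q.1, q.2 i = i
    · by_cases hj : j ∈ q.1
      · simp [hj]
      · rw [if_pos hq, if_neg hj, Finset.mul_sum, ← Finset.sum_filter]
        exact Finset.sum_congr (by ext; simp [hj]; tauto) fun _ _ => rfl
    · simp [hq]
  have h3 : ∑ q : Finset (Fin n) × Perm (Fin n) with (∀ i ∈ q.1, q.2 i = i),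
      coef x a q.1 q.2 * (if j ∈ q.1 then ∑ l ∈ q.1ᶜ, F (q.1.erase j) (q.2 * swap j l) else 0) =
      ∑ q : (Finset (Fin n) × Perm (Fin n)) × Fin n with
        (∀ i ∈ q.1.1, q.1.2 i = i) ∧ j ∈ q.1.1 ∧ q.2 ∉ q.1.1,
        coef x a q.1.1 q.1.2 * F (q.1.1.erase j) (q.1.2 * swap j q.2) := by
    rw [Finset.sum_filter, Finset.sum_filter,
      Fintype.sum_prod_type (α₁ := Finset (Fin n) × Perm (Fin n)) (α₂ := Fin n)]
    refine Finset.sum_congr rfl fun q _ => ?_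
    by_cases hq : ∀ i ∈ q.1, q.2 i = i
    · by_cases hj : j ∈ q.1
      · rw [if_pos hq, if_pos hj, Finset.mul_sum, ← Finset.sum_filter]
        exact Finset.sum_congr (by ext; simp [hj]; tauto) fun _ _ => rfl
      · simp [hj]
    · simp [hq]
  have h4 : ∀ q : Finset (Fin n) × Perm (Fin n), coef x a q.1 q.2 * ((a (q.2 j) - a j) * F q.1 q.2 +
        if j ∈ q.1 then -∑ l ∈ q.1ᶜ, F (q.1.erase j) (q.2 * swap j l)
        else ∑ i ∈ q.1, F (q.1.erase i) (q.2 * swap i j)) =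
      coef x a q.1 q.2 * ((a (q.2 j) - a j) * F q.1 q.2) +
      coef x a q.1 q.2 * (if j ∈ q.1 then 0 else ∑ i ∈ q.1, F (q.1.erase i) (q.2 * swap i j)) -
      coef x a q.1 q.2 * (if j ∈ q.1 then ∑ l ∈ q.1ᶜ, F (q.1.erase j) (q.2 * swap j l) else 0) := by
    intro q
    split_ifs <;> ring
  simp_rw [h4]
  rw [Finset.sum_sub_distrib, Finset.sum_add_distrib, h1, h2, h3, sum_insert_image,
    sum_insert_point, ← Finset.sum_add_distrib, ← Finset.sum_sub_distrib]
  exact Finset.sum_eq_zero fun q _ => by ring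

end Antisymmetrizer

section Commutator

variable {n : ℕ} {A : Type*} [Ring A] (s : Perm (Fin n) →* A) (x y : Fin n → A)
  (hs : ∀ (σ : Perm (Fin n)) i, s σ * y i = y (σ i) * s σ)
  (h₁ : ∀ i j, i ≠ j → y i * x j = x j * y i + s (swap i j))
  (h₂ : ∀ i, y i * x i = x i * y i - ∑ k ∈ Finset.univ.erase i, s (swap i k))

include hs h₁ h₂

theorem commute_commutator_right {i j : Fin n} (hij : i ≠ j) :
    Commute (y i * y j - y j * y i) (x j) := by
  have e1 := hs (swap i j) j
  have e2 := hs (swap i j) i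
  rw [swap_apply_right] at e1
  rw [swap_apply_left] at e2
  have e3 : y i * ∑ k ∈ Finset.univ.erase j, s (swap j k) =
      (∑ k ∈ Finset.univ.erase j, s (swap j k)) * y i + y i * s (swap i j) - s (swap i j) * y i := by
    have hi : i ∈ Finset.univ.erase j := by simp [hij]
    rw [← Finset.add_sum_erase _ _ hi, mul_add, add_mul, Finset.mul_sum, Finset.sum_mul,
      swap_comm j i]
    have : ∀ k ∈ (Finset.univ.erase j).erase i, y i * s (swap j k) = s (swap j k) * y i := by
      intro k hk
      simp only [Finset.mem_erase, Finset.mem_univ, and_true] at hk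
      rw [hs, swap_apply_of_ne_of_ne hij hk.1.symm]
    rw [Finset.sum_congr rfl this]
    abel
  rw [Commute, SemiconjBy, sub_mul, mul_assoc, h₂, mul_sub, ← mul_assoc, h₁ i j hij, mul_assoc,
    h₁ i j hij, mul_add, ← mul_assoc, h₂, e3, ← e2]
  have e4 : y i * s (swap i j) = s (swap i j) * y j := e1.symm
  rw [e4]
  noncomm_ring

theorem commute_commutator {i j : Fin n} (hij : i ≠ j) (k : Fin n) :
    Commute (y i * y j - y j * y i) (x k) := by
  rcases eq_or_ne k j with rfl | hj
  · exact commute_commutator_right s x y hs h₁ h₂ hij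
  rcases eq_or_ne k i with rfl | hi
  · rw [← neg_sub]
    exact (commute_commutator_right s x y hs h₁ h₂ hij.symm).neg_left
  have e1 := hs (swap j k) i
  have e2 := hs (swap i k) j
  rw [swap_apply_of_ne_of_ne hij hi.symm] at e1
  rw [swap_apply_of_ne_of_ne hij.symm hj.symm] at e2
  rw [Commute, SemiconjBy, sub_mul, mul_assoc, h₁ j k hj.symm, mul_add, ← mul_assoc,
    h₁ i k hi.symm, mul_assoc (y j), h₁ i k hi.symm, mul_add, ← mul_assoc (y j), h₁ j k hj.symm,
    ← e1, ← e2]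
  noncomm_ring

end Commutator

section Shift

variable {n : ℕ} {A : Type*} [Ring A] {s : Perm (Fin n) →* A} {x y : Fin n → A}
  {c : A} (hc : ∀ a, Commute c a)

include hc

theorem map_mul_shift (hs : ∀ (σ : Perm (Fin n)) i, s σ * y i = y (σ i) * s σ)
    (σ : Perm (Fin n)) (i : Fin n) : s σ * (c - y i) = (c - y (σ i)) * s σ := by
  rw [mul_sub, sub_mul, hs, (hc _).eq]

theorem shift_mul (h₁ : ∀ i j, i ≠ j → y i * x j = x j * y i - s (swap i j)) (i j : Fin n)
    (hij : i ≠ j) : (c - y i) * x j = x j * (c - y i) + s (swap i j) := by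
  rw [mul_sub, sub_mul, h₁ i j hij, (hc _).eq]
  abel

theorem shift_mul_self
    (h₂ : ∀ i, y i * x i = x i * y i + ∑ k ∈ Finset.univ.erase i, s (swap i k)) (i : Fin n) :
    (c - y i) * x i = x i * (c - y i) - ∑ k ∈ Finset.univ.erase i, s (swap i k) := by
  rw [mul_sub, sub_mul, h₂ i, (hc _).eq]
  abel

theorem commute_shift (hy : ∀ i j, Commute (y i) (y j)) (i j : Fin n) :
    Commute (c - y i) (c - y j) :=
  ((hc _).sub_left ((hc _).symm.sub_right (hy i j)))

omit hc in
theorem zero_sub_commutator (a b : A) :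
    (0 - a) * (0 - b) - (0 - b) * (0 - a) = a * b - b * a := by
  noncomm_ring

end Shift

section Representation

variable {n : ℕ} (z p : Fin n → ℂ)

/-- Multiplication by the `i`-th coordinate. -/
def pos (i : Fin n) : Module.End ℂ (Perm (Fin n) → ℂ) where
  toFun f w := z (w i) * f w
  map_add' f g := by ext w; simp [mul_add]
  map_smul' c f := by ext w; simp [mul_left_comm]

/-- The action of permutations by right translation. -/
def trans : Perm (Fin n) →* Module.End ℂ (Perm (Fin n) → ℂ) where
  toFun σ := LinearMap.funLeft ℂ ℂ (fun w => w * σ)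
  map_one' := by ext; simp
  map_mul' σ τ := by ext; simp [LinearMap.funLeft, Function.comp_def, mul_assoc]

/-- The Dunkl operator with momenta `p`; the summand with `k = i` vanishes. -/
noncomputable def dunkl (i : Fin n) : Module.End ℂ (Perm (Fin n) → ℂ) where
  toFun f w := p (w i) * f w - ∑ k, f (w * swap i k) / (z (w i) - z (w k))
  map_add' f g := by
    ext w
    simp only [Pi.add_apply, add_div, Finset.sum_add_distrib]
    ring
  map_smul' c f := by
    ext w
    simp only [Pi.smul_apply, smul_eq_mul, mul_div_assoc, ← Finset.mul_sum, RingHom.id_apply]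
    ring

theorem pos_apply (i : Fin n) (f : Perm (Fin n) → ℂ) (w : Perm (Fin n)) :
    pos z i f w = z (w i) * f w := rfl

theorem trans_apply (σ : Perm (Fin n)) (f : Perm (Fin n) → ℂ) (w : Perm (Fin n)) :
    trans σ f w = f (w * σ) := rfl

theorem dunkl_apply (i : Fin n) (f : Perm (Fin n) → ℂ) (w : Perm (Fin n)) :
    dunkl z p i f w = p (w i) * f w - ∑ k, f (w * swap i k) / (z (w i) - z (w k)) := rfl

theorem trans_mul_dunkl (σ : Perm (Fin n)) (i : Fin n) :
    trans σ * dunkl z p i = dunkl z p (σ i) * trans σ := by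
  refine LinearMap.ext fun f => funext fun w => ?_
  simp only [Module.End.mul_apply, trans_apply, dunkl_apply, Perm.mul_apply]
  congr 1
  refine Eq.trans ?_ (Equiv.sum_comp σ _)
  refine Finset.sum_congr rfl fun k _ => ?_
  rw [swap_apply_apply]
  simp [mul_assoc]

variable {z}

theorem dunkl_mul_pos (hz : Function.Injective z) {i j : Fin n} (hij : i ≠ j) :
    dunkl z p i * pos z j = pos z j * dunkl z p i - trans (swap i j) := by
  refine LinearMap.ext fun f => funext fun w => ?_
  simp only [Module.End.mul_apply, LinearMap.sub_apply, Pi.sub_apply, trans_apply, dunkl_apply,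
    pos_apply, Perm.mul_apply]
  have h : ∑ k, z (w (swap i k j)) * f (w * swap i k) / (z (w i) - z (w k)) =
      ∑ k, z (w j) * (f (w * swap i k) / (z (w i) - z (w k))) + f (w * swap i j) := by
    rw [← sub_eq_iff_eq_add', ← Finset.sum_sub_distrib, Finset.sum_eq_single j]
    · have : z (w i) - z (w j) ≠ 0 := sub_ne_zero.2 fun h => hij (w.injective (hz h))
      rw [swap_apply_right]
      field_simp
    · intro k _ hk
      rw [swap_apply_of_ne_of_ne hij.symm hk.symm]
      ring
    · simp
  rw [h, ← Finset.mul_sum]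
  ring

theorem dunkl_mul_pos_self (hz : Function.Injective z) (i : Fin n) :
    dunkl z p i * pos z i =
      pos z i * dunkl z p i + ∑ k ∈ Finset.univ.erase i, trans (swap i k) := by
  refine LinearMap.ext fun f => funext fun w => ?_
  simp only [Module.End.mul_apply, LinearMap.add_apply, Pi.add_apply, trans_apply, dunkl_apply,
    pos_apply, Perm.mul_apply, LinearMap.sum_apply, Finset.sum_apply, swap_apply_left]
  have h : ∑ k, z (w k) * f (w * swap i k) / (z (w i) - z (w k)) =
      ∑ k, z (w i) * (f (w * swap i k) / (z (w i) - z (w k))) -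
        ∑ k ∈ Finset.univ.erase i, f (w * swap i k) := by
    rw [← Finset.add_sum_erase _ _ (Finset.mem_univ i), ← Finset.add_sum_erase (Finset.univ) (fun k =>
      z (w i) * (f (w * swap i k) / (z (w i) - z (w k)))) (Finset.mem_univ i), add_sub_assoc,
      ← Finset.sum_sub_distrib]
    congr 1
    · simp
    · refine Finset.sum_congr rfl fun k hk => ?_
      have : z (w i) - z (w k) ≠ 0 :=
        sub_ne_zero.2 fun h => (Finset.ne_of_mem_erase hk).symm (w.injective (hz h))
      field_simp
      ring
  rw [h, ← Finset.mul_sum]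
  ring

/-- An operator which commutes with the coordinates is a multiplication operator. -/
theorem apply_of_commute_pos (hz : Function.Injective z) {C : Module.End ℂ (Perm (Fin n) → ℂ)}
    (hC : ∀ j, Commute C (pos z j)) (f : Perm (Fin n) → ℂ) (w : Perm (Fin n)) :
    C f w = C 1 w * f w := by
  have key : ∀ v, w ≠ v → C (fun j => if v = j then 1 else 0) w = 0 := by
    intro v hv
    by_contra h
    apply hv
    ext j : 1
    have h1 := congrFun (LinearMap.congr_fun (hC j).eq (fun j => if v = j then 1 else 0)) w
    simp only [Module.End.mul_apply, pos_apply] at h1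
    have h2 : pos z j (fun j => if v = j then (1 : ℂ) else 0) =
        z (v j) • (fun j => if v = j then (1 : ℂ) else 0) := by
      ext u
      simp only [pos_apply, Pi.smul_apply, smul_eq_mul]
      split_ifs with h
      · rw [h]
      · simp
    rw [h2, map_smul, Pi.smul_apply, smul_eq_mul] at h1
    exact (hz (mul_right_cancel₀ h h1)).symm
  have hf : ∀ g : Perm (Fin n) → ℂ, C g w = g w * C (fun j => if w = j then 1 else 0) w := by
    intro g
    rw [LinearMap.pi_apply_eq_sum_univ C g, Finset.sum_apply, Finset.sum_eq_single w]
    · rfl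
    · intro v _ hv
      rw [Pi.smul_apply, key v hv.symm, smul_zero]
    · simp
  rw [hf f, hf 1, Pi.one_apply]
  ring

theorem eq_smul_of_commute (hz : Function.Injective z) {C : Module.End ℂ (Perm (Fin n) → ℂ)}
    (hC : ∀ j, Commute C (pos z j)) (hC' : ∀ σ, Commute C (trans σ)) (f : Perm (Fin n) → ℂ) :
    C f = C 1 1 • f := by
  ext w
  rw [apply_of_commute_pos hz hC, Pi.smul_apply, smul_eq_mul]
  have := congrFun (LinearMap.congr_fun (hC' w).eq 1) 1
  simp only [Module.End.mul_apply, trans_apply, one_mul] at this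
  rw [← this]
  rfl

theorem dunkl_apply_comp (i j : Fin n) (g : Fin n → ℂ) (w : Perm (Fin n)) (hij : i ≠ j) :
    dunkl z p i (fun w => g (w j)) w = p (w i) * g (w j) -
      g (w i) / (z (w i) - z (w j)) -
      ∑ k ∈ Finset.univ.erase j, g (w j) / (z (w i) - z (w k)) := by
  rw [dunkl_apply, ← Finset.add_sum_erase _ _ (Finset.mem_univ j), sub_sub]
  congr 2
  · simp
  · refine Finset.sum_congr rfl fun k hk => ?_
    rw [Perm.mul_apply, swap_apply_of_ne_of_ne hij.symm (Finset.ne_of_mem_erase hk).symm]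

theorem dunkl_one : ∃ g : Fin n → ℂ, (∀ a, g a = p a - ∑ b, 1 / (z a - z b)) ∧
    ∀ j, dunkl z p j 1 = fun w => g (w j) := by
  refine ⟨_, fun _ => rfl, fun j => funext fun w => ?_⟩
  rw [dunkl_apply]
  simp only [Pi.one_apply, mul_one]
  congr 1
  exact Equiv.sum_comp w fun b => 1 / (z (w j) - z b)

theorem dunkl_dunkl_one (i j : Fin n) (hij : i ≠ j) (w : Perm (Fin n)) :
    dunkl z p i (dunkl z p j 1) w = dunkl z p i 1 w * dunkl z p j 1 w -
      (dunkl z p i 1 w - dunkl z p j 1 w) / (z (w i) - z (w j)) := by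
  obtain ⟨g, hg, hd⟩ := dunkl_one (z := z) p
  rw [hd j, hd i, dunkl_apply_comp p i j _ w hij]
  simp only [div_eq_mul_inv, ← Finset.mul_sum]
  have h1 : ∑ b, (z (w i) - z b)⁻¹ =
      (z (w i) - z (w j))⁻¹ + ∑ k ∈ Finset.univ.erase j, (z (w i) - z (w k))⁻¹ := by
    rw [Finset.add_sum_erase _ (fun k => (z (w i) - z (w k))⁻¹) (Finset.mem_univ j)]
    exact (Equiv.sum_comp w fun b => (z (w i) - z b)⁻¹).symm
  have h2 := hg (w i)
  simp only [one_div] at h2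
  rw [h1] at h2
  linear_combination (-g (w j)) * h2

theorem dunkl_commute (hz : Function.Injective z) (i j : Fin n) :
    Commute (dunkl z p i) (dunkl z p j) := by
  rcases eq_or_ne i j with rfl | hij
  · exact Commute.refl _
  have hC := commute_commutator trans (pos z) (fun i => 0 - dunkl z p i)
    (map_mul_shift Commute.zero_left (trans_mul_dunkl z p))
    (shift_mul Commute.zero_left fun i j hij => dunkl_mul_pos p hz hij)
    (shift_mul_self Commute.zero_left (dunkl_mul_pos_self p hz)) hij
  replace hC : ∀ k, Commute (dunkl z p i * dunkl z p j - dunkl z p j * dunkl z p i) (pos z k) :=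
    fun k => (congrArg (Commute · (pos z k)) (zero_sub_commutator _ _)).mp (hC k)
  rw [Commute, SemiconjBy, ← sub_eq_zero]
  refine LinearMap.ext fun f => funext fun w => ?_
  rw [apply_of_commute_pos hz hC f w, LinearMap.sub_apply, Pi.sub_apply, Module.End.mul_apply,
    Module.End.mul_apply, dunkl_dunkl_one p i j hij, dunkl_dunkl_one p j i hij.symm,
    ← neg_sub (z (w i)) (z (w j))]
  simp only [LinearMap.zero_apply, Pi.zero_apply, div_neg]
  ring

end Representation

section ShiftedDunkl

variable {n : ℕ} {z : Fin n → ℂ} (p : Fin n → ℂ) (hz : Function.Injective z)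

/-- The products of the commuting operators `u - dunkl z p i`. -/
noncomputable def shiftedProd (u : ℂ) (T : Finset (Fin n)) : Module.End ℂ (Perm (Fin n) → ℂ) :=
  prodOver (fun i => algebraMap ℂ _ u - dunkl z p i)
    (commute_shift (Algebra.commute_algebraMap_left u) (dunkl_commute p hz)) T

theorem shiftedProd_mul_pos_of_notMem (u : ℂ) (j : Fin n) (T : Finset (Fin n)) (hj : j ∉ T) :
    shiftedProd p hz u T * pos z j = pos z j * shiftedProd p hz u T +
      ∑ i ∈ T, trans (swap i j) * shiftedProd p hz u (T.erase i) :=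
  prodOver_mul_of_notMem trans (pos z) _ _
    (map_mul_shift (Algebra.commute_algebraMap_left u) (trans_mul_dunkl z p))
    (shift_mul (Algebra.commute_algebraMap_left u) fun _ _ hij => dunkl_mul_pos p hz hij) j T hj

theorem shiftedProd_mul_pos_of_mem (u : ℂ) (j : Fin n) (T : Finset (Fin n)) (hj : j ∈ T) :
    shiftedProd p hz u T * pos z j = pos z j * shiftedProd p hz u T -
      ∑ l ∈ Tᶜ, trans (swap j l) * shiftedProd p hz u (T.erase j) :=
  prodOver_mul_of_mem trans (pos z) _ _
    (map_mul_shift (Algebra.commute_algebraMap_left u) (trans_mul_dunkl z p))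
    (shift_mul (Algebra.commute_algebraMap_left u) fun _ _ hij => dunkl_mul_pos p hz hij)
    (shift_mul_self (Algebra.commute_algebraMap_left u) (dunkl_mul_pos_self p hz)) j T hj

theorem trans_mul_shiftedProd (u : ℂ) (σ : Perm (Fin n)) (T : Finset (Fin n)) :
    trans σ * shiftedProd p hz u T = shiftedProd p hz u (T.map σ.toEmbedding) * trans σ :=
  map_mul_prodOver trans _ _
    (map_mul_shift (Algebra.commute_algebraMap_left u) (trans_mul_dunkl z p)) σ T

theorem commute_trans_shiftedProd (u : ℂ) (σ : Perm (Fin n)) (T : Finset (Fin n))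
    (h : ∀ i ∈ T, σ i = i) : Commute (trans σ) (shiftedProd p hz u T) :=
  commute_map_prodOver trans _ _
    (map_mul_shift (Algebra.commute_algebraMap_left u) (trans_mul_dunkl z p)) σ T h

theorem shiftedProd_erase_apply (u : ℂ) {i : Fin n} {T : Finset (Fin n)} (hi : i ∈ T)
    (f : Perm (Fin n) → ℂ) :
    shiftedProd p hz u (T.erase i) (u • f - dunkl z p i f) = shiftedProd p hz u T f := by
  have h1 := mul_prodOver_erase (fun i => algebraMap ℂ _ u - dunkl z p i)
    (commute_shift (Algebra.commute_algebraMap_left u) (dunkl_commute p hz)) hi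
  have h2 := (commute_prodOver (fun i => algebraMap ℂ _ u - dunkl z p i)
    (commute_shift (Algebra.commute_algebraMap_left u) (dunkl_commute p hz)) i (T.erase i)).eq
  exact LinearMap.congr_fun (h2.symm.trans h1) f

theorem shiftedProd_apply_eigenvector (u : ℂ) {ν : Fin n → ℂ} {v : Perm (Fin n) → ℂ}
    (hv : ∀ i, dunkl z p i v = ν i • v) (T : Finset (Fin n)) :
    shiftedProd p hz u T v = (∏ i ∈ T, (u - ν i)) • v := by
  induction T using Finset.induction_on with
  | empty => simp [shiftedProd, prodOver_empty]
  | insert a T ha ih =>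
    rw [← shiftedProd_erase_apply p hz u (Finset.mem_insert_self a T), Finset.erase_insert ha,
      hv a, ← sub_smul, map_smul, ih, Finset.prod_insert ha, smul_smul]

theorem shiftedProd_univ_apply (u : ℂ) {ν : Fin n → ℂ} {v : Perm (Fin n) → ℂ} (hv0 : v ≠ 0)
    (hv : ∀ i, dunkl z p i v = ν i • v) (f : Perm (Fin n) → ℂ) :
    shiftedProd p hz u Finset.univ f = (∏ i, (u - ν i)) • f := by
  have h := eq_smul_of_commute (C := shiftedProd p hz u Finset.univ) hz
    (fun j => by
      rw [Commute, SemiconjBy, shiftedProd_mul_pos_of_mem p hz u j _ (Finset.mem_univ j)]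
      simp)
    (fun σ => by
      have := trans_mul_shiftedProd p hz u σ Finset.univ
      rw [Finset.map_univ_equiv] at this
      exact this.symm)
  have h1 := h v
  rw [shiftedProd_apply_eigenvector p hz u hv] at h1
  rw [h f, smul_left_injective ℂ hv0 h1]

theorem sum_shiftedProd_erase_apply (u : ℂ) {ν : Fin n → ℂ} {v : Perm (Fin n) → ℂ} (hv0 : v ≠ 0)
    (hv : ∀ i, dunkl z p i v = ν i • v) (f : Perm (Fin n) → ℂ) :
    ∑ l, shiftedProd p hz u (Finset.univ.erase l) f =
      (∑ l, ∏ i ∈ Finset.univ.erase l, (u - ν i)) • f := by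
  have h := eq_smul_of_commute (C := ∑ l, shiftedProd p hz u (Finset.univ.erase l)) hz
    (fun j => by
      rw [Commute, SemiconjBy, Finset.sum_mul, Finset.mul_sum,
        ← Finset.add_sum_erase _ _ (Finset.mem_univ j),
        shiftedProd_mul_pos_of_notMem p hz u j _ (Finset.notMem_erase j _),
        ← Finset.add_sum_erase _ (fun l => pos z j * shiftedProd p hz u (Finset.univ.erase l))
        (Finset.mem_univ j), add_assoc, ← Finset.sum_add_distrib]
      congr 1
      refine Finset.sum_congr rfl fun l hl => ?_
      have hlj := (Finset.ne_of_mem_erase hl).symm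
      rw [shiftedProd_mul_pos_of_mem p hz u j _ (Finset.mem_erase.2 ⟨hlj, Finset.mem_univ j⟩),
        Finset.compl_erase]
      simp [Finset.erase_right_comm (a := j), swap_comm])
    (fun σ => by
      rw [Commute, SemiconjBy, Finset.sum_mul, Finset.mul_sum]
      simp_rw [trans_mul_shiftedProd, Finset.map_erase, Finset.map_univ_equiv]
      exact (Equiv.sum_comp σ fun l =>
        shiftedProd p hz u (Finset.univ.erase l) * trans σ).symm)
  have h1 := h v
  simp only [LinearMap.sum_apply, shiftedProd_apply_eigenvector p hz u hv, ← Finset.sum_smul]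
    at h1 h
  rw [h f, smul_left_injective ℂ hv0 h1]

/-- The antisymmetrized generating operator. -/
noncomputable def antisymmetrized (x u : ℂ) : Module.End ℂ (Perm (Fin n) → ℂ) where
  toFun f w := ∑ q : Finset (Fin n) × Perm (Fin n) with (∀ i ∈ q.1, q.2 i = i),
    coef x (z ∘ w) q.1 q.2 * shiftedProd p hz u q.1 f (w * q.2)
  map_add' f g := by
    ext w
    simp [mul_add, Finset.sum_add_distrib]
  map_smul' c f := by
    ext w
    simp [mul_left_comm _ c, Finset.mul_sum]

theorem antisymmetrized_apply (x u : ℂ) (f : Perm (Fin n) → ℂ) (w : Perm (Fin n)) :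
    antisymmetrized p hz x u f w =
      ∑ q : Finset (Fin n) × Perm (Fin n) with (∀ i ∈ q.1, q.2 i = i),
        coef x (z ∘ w) q.1 q.2 * shiftedProd p hz u q.1 f (w * q.2) := rfl

theorem commute_antisymmetrized_pos (x u : ℂ) (j : Fin n) :
    Commute (antisymmetrized p hz x u) (pos z j) := by
  refine LinearMap.ext fun f => funext fun w => ?_
  rw [← sub_eq_zero, ← antisymmetrizer_identity x (z ∘ w) j
    (fun T σ => shiftedProd p hz u T f (w * σ)), Module.End.mul_apply, Module.End.mul_apply,
    antisymmetrized_apply, pos_apply, antisymmetrized_apply, Finset.mul_sum,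
    ← Finset.sum_sub_distrib]
  refine Finset.sum_congr rfl fun q _ => ?_
  split_ifs with h
  · have h1 := congrFun (LinearMap.congr_fun (shiftedProd_mul_pos_of_mem p hz u j q.1 h) f)
      (w * q.2)
    simp only [Module.End.mul_apply, LinearMap.sub_apply, Pi.sub_apply, LinearMap.sum_apply,
      Finset.sum_apply, pos_apply, trans_apply, mul_assoc] at h1
    rw [h1]
    simp only [Function.comp, Perm.mul_apply]
    ring
  · have h1 := congrFun (LinearMap.congr_fun (shiftedProd_mul_pos_of_notMem p hz u j q.1 h) f)
      (w * q.2)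
    simp only [Module.End.mul_apply, LinearMap.add_apply, Pi.add_apply, LinearMap.sum_apply,
      Finset.sum_apply, pos_apply, trans_apply, mul_assoc] at h1
    rw [h1]
    simp only [Function.comp, Perm.mul_apply]
    ring

theorem sum_sign_eq_zero {T : Finset (Fin n)} (hT : 2 ≤ Tᶜ.card) :
    ∑ σ : Perm (Fin n) with (∀ i ∈ T, σ i = i), ((Perm.sign σ : ℤ) : ℂ) = 0 := by
  obtain ⟨a, b, ha, hb, hab⟩ := Finset.one_lt_card_iff.1 hT
  rw [Finset.mem_compl] at ha hb
  refine Finset.sum_involution (fun σ _ => σ * swap a b) ?_ ?_ ?_ ?_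
  · intro σ _
    simp [Perm.sign_mul, Perm.sign_swap hab]
  · intro σ _ _ h
    have := congrArg (σ⁻¹ * ·) h
    simp only [inv_mul_cancel_left, inv_mul_cancel] at this
    exact hab (swap_eq_one_iff.1 this)
  · intro σ hσ
    simp only [Finset.mem_filter, Finset.mem_univ, true_and] at hσ ⊢
    intro i hi
    rw [Perm.mul_apply, swap_apply_of_ne_of_ne (ne_of_mem_of_not_mem hi ha)
      (ne_of_mem_of_not_mem hi hb), hσ i hi]
  · intro σ _
    simp [mul_assoc]

theorem sum_sign_eq_one {T : Finset (Fin n)} (hT : Tᶜ.card ≤ 1) :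
    ∑ σ : Perm (Fin n) with (∀ i ∈ T, σ i = i), ((Perm.sign σ : ℤ) : ℂ) = 1 := by
  have : (Finset.univ.filter fun σ : Perm (Fin n) => ∀ i ∈ T, σ i = i) = {1} := by
    ext σ
    simp only [Finset.mem_filter, Finset.mem_univ, true_and, Finset.mem_singleton]
    constructor
    · intro h
      by_contra h1
      have h2 := Perm.two_le_card_support_of_ne_one h1
      have h3 : σ.support ⊆ Tᶜ := fun i hi => by
        rw [Finset.mem_compl]
        exact fun hiT => Perm.mem_support.1 hi (h i hiT)
      have := Finset.card_le_card h3
      omega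
    · rintro rfl
      simp
  rw [this]
  simp

theorem sum_finset_of_card_compl {M : Type*} [AddCommMonoid M] (G : Finset (Fin n) → M)
    (hG : ∀ T : Finset (Fin n), 2 ≤ Tᶜ.card → G T = 0) :
    ∑ T, G T = G Finset.univ + ∑ j, G (Finset.univ.erase j) := by
  have hinj : Function.Injective fun j : Fin n => Finset.univ.erase j := by
    intro i j h
    by_contra hij
    have : i ∈ Finset.univ.erase j := Finset.mem_erase.2 ⟨hij, Finset.mem_univ i⟩
    rw [← show Finset.univ.erase i = Finset.univ.erase j from h] at this
    exact Finset.notMem_erase i _ this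
  rw [← Finset.sum_image (f := G) (g := fun j => Finset.univ.erase j) hinj.injOn,
    ← Finset.sum_insert]
  · symm
    refine Finset.sum_subset (Finset.subset_univ _) fun T _ hT => hG T ?_
    by_contra h
    apply hT
    rw [Finset.mem_insert, Finset.mem_image]
    rcases (by omega : Tᶜ.card = 0 ∨ Tᶜ.card = 1) with h | h
    · left
      rwa [Finset.card_eq_zero, Finset.compl_eq_empty_iff] at h
    · right
      obtain ⟨j, hj⟩ := Finset.card_eq_one.1 h
      exact ⟨j, Finset.mem_univ j, by rw [← compl_compl T, hj, Finset.compl_singleton]⟩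
  · simp only [Finset.mem_image, Finset.mem_univ, true_and, not_exists]
    intro j h
    have h1 := Finset.mem_univ j
    rw [← h] at h1
    exact Finset.notMem_erase j _ h1

theorem antisymmetrized_one (x u : ℂ) (w : Perm (Fin n)) :
    antisymmetrized p hz x u 1 w =
      (∏ i, (x - z (w i))) * shiftedProd p hz u Finset.univ 1 w -
        ∑ j, (∏ i ∈ Finset.univ.erase j, (x - z (w i))) *
          shiftedProd p hz u (Finset.univ.erase j) 1 w := by
  have h1 : antisymmetrized p hz x u 1 w = ∑ T : Finset (Fin n),
      (-1) ^ Tᶜ.card * (∏ i ∈ T, (x - z (w i))) * shiftedProd p hz u T 1 w *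
        ∑ σ : Perm (Fin n) with (∀ i ∈ T, σ i = i), ((Perm.sign σ : ℤ) : ℂ) := by
    rw [antisymmetrized_apply, Finset.sum_filter, Fintype.sum_prod_type]
    refine Finset.sum_congr rfl fun T _ => ?_
    rw [← Finset.sum_filter, Finset.mul_sum]
    refine Finset.sum_congr rfl fun σ hσ => ?_
    have h2 := congrFun (LinearMap.congr_fun
      (commute_trans_shiftedProd p hz u σ T (Finset.mem_filter.1 hσ).2).eq 1) w
    simp only [Module.End.mul_apply, trans_apply] at h2
    rw [h2, show trans σ 1 = 1 from rfl, coef]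
    simp only [Function.comp]
    ring
  rw [h1, sum_finset_of_card_compl _ fun T hT => by rw [sum_sign_eq_zero hT, mul_zero],
    sub_eq_add_neg, ← Finset.sum_neg_distrib, sum_sign_eq_one (by simp)]
  congr 1
  · simp
  · refine Finset.sum_congr rfl fun j _ => ?_
    rw [sum_sign_eq_one (by simp [Finset.compl_erase])]
    simp [Finset.compl_erase]

end ShiftedDunkl

section Output

variable {n : ℕ} {z : Fin n → ℂ} (p : Fin n → ℂ) (hz : Function.Injective z)

theorem mul_eq_neg_mul_shiftedProd {u c m : ℂ} {r : Fin n → ℂ}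
    (hc : ∀ f, shiftedProd p hz u Finset.univ f = c • f)
    (hr : ∀ i, (u - p i) * r i + ∑ j, r j / (z i - z j) = -m) (j : Fin n) (w : Perm (Fin n)) :
    c * r (w j) = -m * shiftedProd p hz u (Finset.univ.erase j) 1 w := by
  have h1 : u • (fun w : Perm (Fin n) => r (w j)) - dunkl z p j (fun w => r (w j)) =
      (-m) • (1 : Perm (Fin n) → ℂ) := by
    ext w
    rw [Pi.sub_apply, Pi.smul_apply, Pi.smul_apply, dunkl_apply, ← hr (w j),
      ← Equiv.sum_comp w fun k => r k / (z (w j) - z k)]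
    simp only [Perm.mul_apply, swap_apply_left, smul_eq_mul, Pi.one_apply]
    ring
  have h2 := shiftedProd_erase_apply p hz u (Finset.mem_univ j) fun w => r (w j)
  rw [h1, hc, map_smul] at h2
  simpa using (congrFun h2 w).symm

theorem isRoot_of_mul_eq_mul_derivative {c m s : ℂ[X]} (hc : c ≠ 0)
    (h : c * s = -m * derivative c) {a : ℂ} (ha : c.IsRoot a) : m.IsRoot a := by
  by_contra hm
  have hk := (rootMultiplicity_pos hc).2 ha
  have h1 : (X - C a) ^ c.rootMultiplicity a ∣ derivative c := by
    refine IsCoprime.dvd_of_dvd_mul_left (IsCoprime.pow_left (m := c.rootMultiplicity a) (y := m)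
      ?_) ?_
    · exact (irreducible_X_sub_C a).coprime_iff_not_dvd.2 fun h => hm (dvd_iff_isRoot.1 h)
    · have h2 := (pow_rootMultiplicity_dvd c a).mul_right s
      rw [h, neg_mul, dvd_neg] at h2
      exact h2
  have h0 : derivative c ≠ 0 := by
    intro h0
    have h3 := derivative_eq_zero.1 h0
    rw [eq_C_of_natDegree_eq_zero h3, IsRoot.def, eval_C] at ha
    rw [eq_C_of_natDegree_eq_zero h3, ha, C_0] at hc
    exact hc rfl
  have h2 := (le_rootMultiplicity_iff h0).2 h1
  rw [derivative_rootMultiplicity_of_root ha] at h2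
  omega

/-- The matrix of the antisymmetrized generating operator, with `u - dunkl z p i` replaced by
`u - ν i`. -/
noncomputable def antisymMatrix (a b ν : Fin n → ℂ) (x u : ℂ) :
    Matrix (Perm (Fin n)) (Perm (Fin n)) ℂ :=
  Matrix.of fun w w' => ∑ T : Finset (Fin n) with (∀ i ∈ T, (w⁻¹ * w') i = i),
    (-1) ^ Tᶜ.card * ((Perm.sign (w⁻¹ * w') : ℤ) : ℂ) *
      ((∏ i ∈ T, (a (w i) * x - b (w i))) * ∏ i ∈ Tᶜ, a (w i)) * ∏ i ∈ T, (u - ν i)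

theorem antisymMatrix_one_mulVec (ν : Fin n → ℂ) (x u : ℂ) (v : Perm (Fin n) → ℂ)
    (w : Perm (Fin n)) :
    (antisymMatrix 1 z ν x u).mulVec v w =
      ∑ q : Finset (Fin n) × Perm (Fin n) with (∀ i ∈ q.1, q.2 i = i),
        coef x (z ∘ w) q.1 q.2 * ((∏ i ∈ q.1, (u - ν i)) * v (w * q.2)) := by
  rw [Matrix.mulVec, dotProduct, ← Equiv.sum_comp (Equiv.mulLeft w), Finset.sum_filter,
    Fintype.sum_prod_type_right]
  refine Finset.sum_congr rfl fun σ _ => ?_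
  simp only [antisymMatrix, Matrix.of_apply, Equiv.coe_mulLeft, inv_mul_cancel_left]
  rw [Finset.sum_mul, Finset.sum_filter]
  refine Finset.sum_congr rfl fun T _ => ?_
  split_ifs
  · simp only [coef, Function.comp, Pi.one_apply, one_mul, Finset.prod_const_one]
    ring
  · rfl

theorem antisymMatrix_smul (a z ν : Fin n → ℂ) (x u : ℂ) :
    antisymMatrix a (a * z) ν x u = (∏ i, a i) • antisymMatrix 1 z ν x u := by
  ext w w'
  simp only [antisymMatrix, Matrix.of_apply, Matrix.smul_apply, smul_eq_mul, Finset.mul_sum]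
  refine Finset.sum_congr rfl fun T _ => ?_
  have h1 : ∏ i, a i = (∏ i ∈ T, a (w i)) * ∏ i ∈ Tᶜ, a (w i) := by
    rw [Finset.prod_mul_prod_compl, Equiv.prod_comp w a]
  have h2 : ∏ i ∈ T, (a (w i) * x - (a * z) (w i)) =
      (∏ i ∈ T, a (w i)) * ∏ i ∈ T, (x - z (w i)) := by
    rw [← Finset.prod_mul_distrib]
    exact Finset.prod_congr rfl fun i _ => by rw [Pi.mul_apply]; ring
  rw [h1, h2]
  simp only [Pi.one_apply, one_mul, Finset.prod_const_one]
  ring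

theorem antisymMatrix_isHermitian {a b ν : Fin n → ℂ} {x u : ℂ} (ha : ∀ i, (a i).im = 0)
    (hb : ∀ i, (b i).im = 0) (hν : ∀ i, (ν i).im = 0) (hx : x.im = 0) (hu : u.im = 0) :
    (antisymMatrix a b ν x u).IsHermitian := by
  have conj_eq : ∀ {t : ℂ}, t.im = 0 → starRingEnd ℂ t = t := fun h => Complex.conj_eq_iff_im.2 h
  ext w w'
  simp only [antisymMatrix, Matrix.conjTranspose_apply, Matrix.of_apply, star_sum, star_mul',
    star_pow, star_neg, star_one]
  have hf : (Finset.univ.filter fun T : Finset (Fin n) => ∀ i ∈ T, (w'⁻¹ * w) i = i) =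
      Finset.univ.filter fun T : Finset (Fin n) => ∀ i ∈ T, (w⁻¹ * w') i = i := by
    ext T
    simp only [Finset.mem_filter, Finset.mem_univ, true_and, Perm.mul_apply, Perm.inv_eq_iff_eq]
    exact forall₂_congr fun i _ => eq_comm
  rw [hf]
  refine Finset.sum_congr rfl fun T hT => ?_
  have h1 : ∀ i ∈ T, w' i = w i := fun i hi => by
    have := (Finset.mem_filter.1 hT).2 i hi
    rwa [Perm.mul_apply, Perm.inv_eq_iff_eq] at this
  have h2 : ∏ i ∈ Tᶜ, a (w' i) = ∏ i ∈ Tᶜ, a (w i) := by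
    have key : ∀ w : Perm (Fin n), ∏ i ∈ Tᶜ, a (w i) = ∏ j ∈ (T.map w.toEmbedding)ᶜ, a j := by
      intro w
      have : (T.map w.toEmbedding)ᶜ = Tᶜ.map w.toEmbedding := by
        ext i
        simp
      rw [this, Finset.prod_map]
      rfl
    have h3 : T.map w.toEmbedding = T.map w'.toEmbedding := by
      rw [Finset.map_eq_image, Finset.map_eq_image]
      exact Finset.image_congr fun i hi => (h1 i hi).symm
    rw [key, key, h3]
  have h3 : Perm.sign (w'⁻¹ * w) = Perm.sign (w⁻¹ * w') := by
    rw [← Perm.sign_inv, mul_inv_rev, inv_inv]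
  rw [h2, h3, Finset.prod_congr rfl fun i hi => by rw [h1 i hi]]
  congr 1
  · congr 1
    · congr 1
      exact map_intCast (starRingEnd ℂ) _
    · rw [star_prod, star_prod]
      congr 1
      · refine Finset.prod_congr rfl fun i _ => ?_
        rw [← starRingEnd_apply, map_sub, map_mul, conj_eq (ha _), conj_eq (hb _), conj_eq hx]
      · exact Finset.prod_congr rfl fun i _ => conj_eq (ha _)
  · rw [star_prod]
    refine Finset.prod_congr rfl fun i _ => ?_
    rw [← starRingEnd_apply, map_sub, conj_eq (hν _), conj_eq hu]

/-- The bispectral identity for the Calogero–Moser matrix with positions `z`. -/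
theorem exists_antisymMatrix_mulVec (hz : Function.Injective z) (m : ℂ[X]) (r : Fin n → ℂ[X])
    (hr : ∀ i u, (u - p i) * (r i).eval u + ∑ j, (r j).eval u / (z i - z j) = -m.eval u) :
    ∃ (ν : Fin n → ℂ) (v : Perm (Fin n) → ℂ), v ≠ 0 ∧ (∀ i, m.IsRoot (ν i)) ∧
      ∀ x u w, m.eval u * (antisymMatrix 1 z ν x u).mulVec v w = (∏ i, (u - ν i)) *
        (m.eval u * ∏ i, (x - z i) +
          ∑ j, (r j).eval u * ∏ i ∈ Finset.univ.erase j, (x - z i)) * v w := by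
  obtain ⟨ν, v, hv0, hv⟩ := exists_common_eigenvector (dunkl z p) (dunkl_commute p hz)
  refine ⟨ν, v, hv0, fun i => ?_, fun x u w => ?_⟩
  · have hc : (∏ i, (X - C (ν i))) ≠ 0 := Finset.prod_ne_zero_iff.2 fun i _ => X_sub_C_ne_zero _
    refine isRoot_of_mul_eq_mul_derivative hc (s := ∑ j, r j) ?_ (a := ν i) ?_
    · refine Polynomial.funext fun u => ?_
      have h1 := sum_shiftedProd_erase_apply p hz u hv0 hv 1
      have h2 := congrFun h1 1
      have h3 := fun j => mul_eq_neg_mul_shiftedProd p hz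
        (shiftedProd_univ_apply p hz u hv0 hv) (fun i => hr i u) j 1
      simp only [Perm.one_apply] at h3
      simp only [eval_mul, eval_prod, eval_sub, eval_X, eval_C, eval_finsetSum, derivative_prod_finset,
        eval_neg, derivative_sub, derivative_X, derivative_C, sub_zero, mul_one]
      rw [Finset.mul_sum, Finset.sum_congr rfl fun j _ => h3 j, ← Finset.mul_sum]
      rw [Finset.sum_apply] at h2
      rw [h2]
      simp
    · simp only [IsRoot.def, eval_prod, eval_sub, eval_X, eval_C]
      exact Finset.prod_eq_zero (Finset.mem_univ i) (sub_self _)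
  · have h1 : (antisymMatrix 1 z ν x u).mulVec v w = antisymmetrized p hz x u v w := by
      rw [antisymMatrix_one_mulVec, antisymmetrized_apply]
      simp only [shiftedProd_apply_eigenvector p hz u hv, Pi.smul_apply, smul_eq_mul]
    have h3 := fun j => mul_eq_neg_mul_shiftedProd p hz
      (shiftedProd_univ_apply p hz u hv0 hv) (fun i => hr i u) j w
    rw [h1, apply_of_commute_pos hz (commute_antisymmetrized_pos p hz x u), antisymmetrized_one,
      shiftedProd_univ_apply p hz u hv0 hv, ← mul_assoc]
    congr 1
    rw [mul_sub, Finset.mul_sum, mul_add, Finset.mul_sum, sub_eq_add_neg, ← Finset.sum_neg_distrib]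
    congr 1
    · rw [← Equiv.prod_comp w fun i => x - z i]
      simp only [Pi.smul_apply, Pi.one_apply, smul_eq_mul]
      ring
    · rw [← Equiv.sum_comp w (fun j =>
        (∏ i, (u - ν i)) * ((r j).eval u * ∏ i ∈ Finset.univ.erase j, (x - z i)))]
      refine Finset.sum_congr rfl fun j _ => ?_
      rw [← mul_assoc (∏ i, (u - ν i)), h3 j]
      have : ∏ i ∈ Finset.univ.erase (w j), (x - z i) =
          ∏ i ∈ Finset.univ.erase j, (x - z (w i)) := by
        refine (Finset.prod_equiv w (fun i => ?_) fun i _ => rfl).symm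
        simp
      rw [this]
      ring

end Output

end Cherednik

namespace QuasiWronskian

/-- The derivation `f' + c f`, i.e. the conjugate of the derivative by `exp (c x)`. -/
noncomputable def twist (c : ℂ) : Module.End ℂ ℂ[X] := derivative + c • 1

theorem twist_apply (c : ℂ) (f : ℂ[X]) : twist c f = derivative f + c • f := rfl

theorem twist_mul (c d : ℂ) (f g : ℂ[X]) :
    twist (c + d) (f * g) = twist c f * g + f * twist d g := by
  simp only [twist_apply, derivative_mul, smul_eq_C_mul, C_add]
  ring

theorem twist_pow_succ_apply (c : ℂ) (k : ℕ) (f : ℂ[X]) :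
    (twist c ^ (k + 1)) f = twist c ((twist c ^ k) f) := by
  rw [pow_succ', Module.End.mul_apply]

theorem twist_pow_one (c : ℂ) (k : ℕ) : (twist c ^ k) 1 = C (c ^ k) := by
  induction k with
  | zero => simp
  | succ k ih => rw [twist_pow_succ_apply, ih, twist_apply]; simp [smul_eq_C_mul, pow_succ']

variable {N : ℕ}

/-- The matrix of twisted derivatives of the polynomials `p j`. -/
noncomputable def jets (μ : Fin N → ℂ) (p : Fin N → ℂ[X]) : Matrix (Fin N) (Fin N) ℂ[X] :=
  Matrix.of fun i j => (twist (μ j) ^ (i : ℕ)) (p j)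

/-- The polynomial part of the Wronskian of the quasipolynomials `exp (μ j x) p j`. -/
noncomputable def wr (μ : Fin N → ℂ) (p : Fin N → ℂ[X]) : ℂ[X] := (jets μ p).det

/-- The cofactors of the Wronskian with one additional function in the last column. -/
noncomputable def cof (μ : Fin N → ℂ) (p : Fin N → ℂ[X]) (k : Fin (N + 1)) : ℂ[X] :=
  (-1) ^ (k + N : ℕ) *
    (Matrix.of fun i j : Fin N => (twist (μ j) ^ (k.succAbove i : ℕ)) (p j)).det

theorem wr_snoc (μ : Fin N → ℂ) (p : Fin N → ℂ[X]) (ν : ℂ) (g : ℂ[X]) :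
    wr (Fin.snoc μ ν : Fin (N + 1) → ℂ) (Fin.snoc p g : Fin (N + 1) → ℂ[X]) =
      ∑ k : Fin (N + 1), cof μ p k * (twist ν ^ (k : ℕ)) g := by
  rw [wr, Matrix.det_succ_column _ (Fin.last N)]
  refine Finset.sum_congr rfl fun k _ => ?_
  have : (jets (Fin.snoc μ ν : Fin (N + 1) → ℂ) (Fin.snoc p g : Fin (N + 1) → ℂ[X])).submatrix
      k.succAbove (Fin.last N).succAbove =
      Matrix.of fun i j : Fin N => (twist (μ j) ^ (k.succAbove i : ℕ)) (p j) := by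
    ext1 i j
    simp [jets]
  rw [this, cof]
  simp only [jets, Matrix.of_apply, Fin.snoc_last, Fin.val_last]
  ring

theorem cof_last (μ : Fin N → ℂ) (p : Fin N → ℂ[X]) : cof μ p (Fin.last N) = wr μ p := by
  simp [cof, wr, jets, ← two_mul]

theorem sum_cof_mul (μ : Fin N → ℂ) (p : Fin N → ℂ[X]) (a : Fin N) :
    ∑ k : Fin (N + 1), cof μ p k * (twist (μ a) ^ (k : ℕ)) (p a) = 0 := by
  rw [← wr_snoc, wr]
  refine Matrix.det_zero_of_column_eq (i := a.castSucc) (j := Fin.last N)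
    (Fin.castSucc_lt_last a).ne fun k => ?_
  simp [jets]

theorem twist_wr {M : ℕ} (μ : Fin (M + 1) → ℂ) (p : Fin (M + 1) → ℂ[X]) :
    cof μ p (Fin.last M).castSucc = -twist (∑ i, μ i) (wr μ p) := by
  have key : ∀ (s : Finset (Fin (M + 1))) (f : Fin (M + 1) → ℂ[X]),
      twist (∑ i ∈ s, μ i) (∏ i ∈ s, f i) =
        ∑ i ∈ s, ∏ j ∈ s, if j = i then twist (μ j) (f j) else f j := by
    intro s f
    induction s using Finset.induction_on with
    | empty => simp [twist_apply]
    | insert a s ha ih =>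
      rw [Finset.sum_insert ha, Finset.prod_insert ha, twist_mul, ih, Finset.sum_insert ha,
        Finset.prod_insert ha, if_pos rfl, Finset.mul_sum]
      congr 1
      · congr 1
        exact Finset.prod_congr rfl fun j hj => by rw [if_neg (ne_of_mem_of_not_mem hj ha)]
      · refine Finset.sum_congr rfl fun i hi => ?_
        rw [Finset.prod_insert ha, if_neg (ne_of_mem_of_not_mem hi ha).symm]
  let A : Fin (M + 1) → Matrix (Fin (M + 1)) (Fin (M + 1)) ℂ[X] := fun r =>
    Matrix.of fun i j => (twist (μ j) ^ (if i = r then (i : ℕ) + 1 else i)) (p j)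
  have h1 : twist (∑ i, μ i) (wr μ p) = ∑ r, (A r).det := by
    rw [wr, Matrix.det_apply, map_sum]
    simp only [Matrix.det_apply]
    rw [Finset.sum_comm]
    refine Finset.sum_congr rfl fun σ _ => ?_
    rw [← Finset.smul_sum, Units.smul_def, Units.smul_def, map_zsmul, key,
      ← Equiv.sum_comp σ fun r => ∏ j, A r (σ j) j]
    congr 1
    refine Finset.sum_congr rfl fun i _ => Finset.prod_congr rfl fun j _ => ?_
    simp only [A, jets, Matrix.of_apply, EmbeddingLike.apply_eq_iff_eq]
    split_ifs
    · rw [twist_pow_succ_apply]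
    · rfl
  have h2 : ∀ r : Fin M, (A r.castSucc).det = 0 := by
    intro r
    refine Matrix.det_zero_of_row_eq (i := r.castSucc) (j := r.succ)
      (Fin.castSucc_lt_succ).ne ?_
    ext1 j
    simp [A, (Fin.castSucc_lt_succ (i := r)).ne']
  rw [h1, Fin.sum_univ_castSucc, Finset.sum_eq_zero fun r _ => h2 r, zero_add, cof]
  have h3 : (A (Fin.last M)) = Matrix.of fun i j : Fin (M + 1) =>
      (twist (μ j) ^ ((Fin.last M).castSucc.succAbove i : ℕ)) (p j) := by
    ext1 i j
    simp only [A, Matrix.of_apply]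
    congr 2
    rcases Fin.eq_castSucc_or_eq_last i with ⟨i, rfl⟩ | rfl
    · rw [if_neg (Fin.castSucc_lt_last i).ne, Fin.succAbove_of_castSucc_lt]
      · rfl
      · exact Fin.castSucc_lt_castSucc_iff.2 (Fin.castSucc_lt_last i)
    · simp
  rw [← h3]
  have : ((Fin.last M).castSucc : ℕ) + (M + 1) = 2 * M + 1 := by
    simp only [Fin.val_castSucc, Fin.val_last]
    ring
  rw [this, pow_succ, pow_mul]
  simp

theorem coeff_prod_sum {ι : Type*} (s : Finset ι) (f : ι → ℂ[X]) (d : ι → ℕ)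
    (h : ∀ i ∈ s, (f i).natDegree ≤ d i) :
    (∏ i ∈ s, f i).coeff (∑ i ∈ s, d i) = ∏ i ∈ s, (f i).coeff (d i) := by
  classical
  induction s using Finset.induction_on with
  | empty => simp
  | insert a s ha ih =>
    rw [Finset.prod_insert ha, Finset.sum_insert ha, Finset.prod_insert ha,
      coeff_mul_add_eq_of_natDegree_le, ih fun i hi => h i (Finset.mem_insert_of_mem hi)]
    · exact h a (Finset.mem_insert_self a s)
    · exact (natDegree_prod_le _ _).trans
        (Finset.sum_le_sum fun i hi => h i (Finset.mem_insert_of_mem hi))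

theorem natDegree_twist_pow_le (c : ℂ) (k : ℕ) {f : ℂ[X]} {d : ℕ} (hf : f.natDegree ≤ d) :
    ((twist c ^ k) f).natDegree ≤ d := by
  induction k with
  | zero => simpa using hf
  | succ k ih =>
    rw [twist_pow_succ_apply, twist_apply]
    refine (natDegree_add_le _ _).trans (max_le ?_ ((natDegree_smul_le _ _).trans ih))
    exact (natDegree_derivative_le _).trans ((Nat.sub_le _ _).trans ih)

theorem coeff_twist_pow (c : ℂ) (k : ℕ) {f : ℂ[X]} {d : ℕ} (hf : f.natDegree ≤ d) :
    ((twist c ^ k) f).coeff d = c ^ k * f.coeff d := by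
  induction k with
  | zero => simp
  | succ k ih =>
    have h : ((twist c ^ k) f).coeff (d + 1) = 0 :=
      coeff_eq_zero_of_natDegree_lt (Nat.lt_succ_of_le (natDegree_twist_pow_le c k hf))
    rw [twist_pow_succ_apply, twist_apply, coeff_add, coeff_derivative, h, coeff_smul, ih,
      smul_eq_mul]
    ring

theorem natDegree_wr_le (μ : Fin N → ℂ) (p : Fin N → ℂ[X]) (d : Fin N → ℕ)
    (h : ∀ i, (p i).natDegree ≤ d i) : (wr μ p).natDegree ≤ ∑ i, d i := by
  rw [wr, Matrix.det_apply]
  refine natDegree_sum_le_of_forall_le _ _ fun σ _ => ?_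
  rw [Units.smul_def]
  refine (natDegree_smul_le _ _).trans ((natDegree_prod_le _ _).trans
    (Finset.sum_le_sum fun i _ => ?_))
  exact natDegree_twist_pow_le _ _ (h i)

theorem coeff_wr (μ : Fin N → ℂ) (p : Fin N → ℂ[X]) (d : Fin N → ℕ)
    (h : ∀ i, (p i).natDegree ≤ d i) :
    (wr μ p).coeff (∑ i, d i) = (Matrix.vandermonde μ).det * ∏ i, (p i).coeff (d i) := by
  rw [wr, Matrix.det_apply, ← Matrix.det_transpose, Matrix.det_apply, finsetSum_coeff,
    Finset.sum_mul]
  refine Finset.sum_congr rfl fun σ _ => ?_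
  rw [Units.smul_def, Units.smul_def, coeff_smul, coeff_prod_sum, smul_mul_assoc,
    ← Finset.prod_mul_distrib]
  · congr 1
    exact Finset.prod_congr rfl fun i _ => coeff_twist_pow _ _ (h i)
  · exact fun i _ => natDegree_twist_pow_le _ _ (h i)

theorem det_vandermonde_snoc (μ : Fin N → ℂ) (u : ℂ) :
    (Matrix.vandermonde (Fin.snoc μ u : Fin (N + 1) → ℂ)).det =
      (Matrix.vandermonde μ).det * ∏ i, (u - μ i) := by
  rw [Matrix.det_vandermonde, Matrix.det_vandermonde, Fin.prod_univ_castSucc,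
    ← Finset.prod_mul_distrib]
  have h1 : Finset.Ioi (Fin.last N) = ∅ := by
    ext i
    simp [Fin.le_last]
  rw [h1, Finset.prod_empty, mul_one]
  refine Finset.prod_congr rfl fun i _ => ?_
  rw [← Finset.filter_lt_eq_Ioi, ← Finset.filter_lt_eq_Ioi, Finset.prod_filter, Finset.prod_filter,
    Fin.prod_univ_castSucc]
  simp [Fin.castSucc_lt_last]

theorem sum_mul_shift (c : Fin (N + 1) → ℂ) (hc : c (Fin.last N) = 0) (f : ℕ → ℂ) :
    ∑ k, c k * f (k + 1) =
      ∑ k, (Fin.cons 0 fun i : Fin N => c i.castSucc : Fin (N + 1) → ℂ) k * f k := by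
  rw [Fin.sum_univ_castSucc, Fin.sum_univ_succ, hc]
  simp

theorem wr_snoc_one (μ : Fin N → ℂ) (p : Fin N → ℂ[X]) (u : ℂ) :
    wr (Fin.snoc μ u : Fin (N + 1) → ℂ) (Fin.snoc p 1 : Fin (N + 1) → ℂ[X]) =
      ∑ k : Fin (N + 1), cof μ p k * C (u ^ (k : ℕ)) := by
  simp_rw [wr_snoc, twist_pow_one]

theorem exists_derivative_wr_snoc_eval (μ : Fin N → ℂ) (p : Fin N → ℂ[X]) {z : ℂ}
    (hz : (wr μ p).eval z = 0) (hz' : (derivative (wr μ p)).eval z ≠ 0) :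
    ∃ t : ℂ, ∀ u : ℂ,
      (derivative (wr (Fin.snoc μ u : Fin (N + 1) → ℂ)
        (Fin.snoc p 1 : Fin (N + 1) → ℂ[X]))).eval z =
      (t - u) * (wr (Fin.snoc μ u : Fin (N + 1) → ℂ)
        (Fin.snoc p 1 : Fin (N + 1) → ℂ[X])).eval z := by
  rcases N with _ | M
  · simp [wr] at hz
  have hlast : (cof μ p (Fin.last (M + 1))).eval z = 0 := by rw [cof_last, hz]
  have hpen : (cof μ p (Fin.last M).castSucc).eval z ≠ 0 := by
    rw [twist_wr, twist_apply]
    simpa [hz] using hz'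
  let c : Fin (M + 2) → ℂ := fun k => (cof μ p k).eval z
  let ρ : Fin (M + 2) → ℂ := fun k => (derivative (cof μ p k)).eval z +
    (Fin.cons 0 fun i : Fin (M + 1) => c i.castSucc : Fin (M + 2) → ℂ) k
  let J : ℕ → Fin (M + 1) → ℂ := fun k a => ((twist (μ a) ^ k) (p a)).eval z
  have hc : ∀ a, ∑ k, c k * J k a = 0 := by
    intro a
    have := congrArg (eval z) (sum_cof_mul μ p a)
    simpa [eval_finsetSum] using this
  have hρ : ∀ a, ∑ k, ρ k * J k a = 0 := by
    intro a
    have h1 := congrArg (fun f => (twist (μ a) f).eval z) (sum_cof_mul μ p a)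
    have h2 : ∀ f g : ℂ[X], twist (μ a) (f * g) = derivative f * g + f * twist (μ a) g := by
      intro f g
      have := twist_mul 0 (μ a) f g
      rwa [zero_add, twist_apply 0, zero_smul, add_zero] at this
    simp only [map_sum, h2, map_zero, eval_zero, eval_finsetSum, eval_add, eval_mul,
      ← twist_pow_succ_apply, Finset.sum_add_distrib] at h1
    rw [sum_mul_shift c hlast fun k => J k a] at h1
    simp only [ρ, add_mul, Finset.sum_add_distrib]
    exact h1
  set κ : Fin (M + 2) := (Fin.last M).castSucc with hκ
  let t := ρ κ / c κ
  have hρc : ∀ k, ρ k = t * c k := by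
    have h0 : ρ κ - t * c κ = 0 := by
      simp only [t]
      rw [div_mul_cancel₀ _ hpen, sub_self]
    let B : Matrix (Fin (M + 1)) (Fin (M + 1)) ℂ := Matrix.of fun i a => J (κ.succAbove i) a
    have hB : B.det ≠ 0 := by
      have h2 : c κ = (-1) ^ ((κ : ℕ) + (M + 1)) * B.det := by
        have h3 : B = (evalRingHom z).mapMatrix
            (Matrix.of fun i j : Fin (M + 1) => (twist (μ j) ^ (κ.succAbove i : ℕ)) (p j)) := by
          ext i a
          simp [B, J]
        rw [h3, ← RingHom.map_det]
        simp only [c, cof, eval_mul, eval_pow, eval_neg, eval_one, coe_evalRingHom]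
      intro h
      rw [h, mul_zero] at h2
      exact hpen h2
    have h1 : Matrix.vecMul (fun i => ρ (κ.succAbove i) - t * c (κ.succAbove i)) B = 0 := by
      ext a
      have h2 : ∑ k, (ρ k - t * c k) * J k a = 0 := by
        simp only [sub_mul, Finset.sum_sub_distrib, hρ, mul_assoc, ← Finset.mul_sum, hc]
        simp
      rw [Fin.sum_univ_succAbove _ κ, h0, zero_mul, zero_add] at h2
      simpa [Matrix.vecMul, dotProduct, B] using h2
    have h3 := Matrix.eq_zero_of_vecMul_eq_zero hB h1
    intro k
    rw [← sub_eq_zero]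
    rcases eq_or_ne k κ with rfl | hk
    · exact h0
    · obtain ⟨i, rfl⟩ := Fin.exists_succAbove_eq hk
      exact congrFun h3 i
  refine ⟨t, fun u => ?_⟩
  rw [sub_mul, eq_sub_iff_add_eq, wr_snoc_one]
  simp only [derivative_sum, derivative_mul, derivative_C, mul_zero, add_zero, eval_finsetSum,
    eval_mul, eval_C]
  have h1 := sum_mul_shift c hlast fun k => u ^ k
  simp only [pow_succ'] at h1
  simp only [Finset.mul_sum]
  have h2 : ∑ k : Fin (M + 2), u * ((cof μ p k).eval z * u ^ (k : ℕ)) =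
      ∑ k, (Fin.cons 0 fun i : Fin (M + 1) => c i.castSucc : Fin (M + 2) → ℂ) k * u ^ (k : ℕ) := by
    rw [← h1]
    exact Finset.sum_congr rfl fun k _ => mul_left_comm _ _ _
  rw [h2, ← Finset.sum_add_distrib]
  refine Finset.sum_congr rfl fun k _ => ?_
  rw [← add_mul, ← mul_assoc]
  congr 1
  exact hρc k

section Nodal

variable {n : ℕ} {z : Fin n → ℂ}

/-- The Lagrange-type expression with nodes `z`. -/
noncomputable def nodal (z : Fin n → ℂ) (a : ℂ) (b : Fin n → ℂ) : ℂ[X] :=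
  C a * ∏ i, (X - C (z i)) + ∑ j, C (b j) * ∏ i ∈ Finset.univ.erase j, (X - C (z i))

theorem eval_nodal (x a : ℂ) (b : Fin n → ℂ) : (nodal z a b).eval x =
    a * ∏ i, (x - z i) + ∑ j, b j * ∏ i ∈ Finset.univ.erase j, (x - z i) := by
  simp [nodal, eval_prod, eval_finsetSum]

theorem eval_nodal_self (a : ℂ) (b : Fin n → ℂ) (i : Fin n) :
    (nodal z a b).eval (z i) = b i * ∏ l ∈ Finset.univ.erase i, (z i - z l) := by
  rw [eval_nodal, Finset.prod_eq_zero (Finset.mem_univ i) (sub_self _), mul_zero, zero_add,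
    Finset.sum_eq_single i]
  · intro j _ hj
    rw [Finset.prod_eq_zero (Finset.mem_erase.2 ⟨hj.symm, Finset.mem_univ i⟩) (sub_self _),
      mul_zero]
  · simp

theorem exists_eval_derivative_nodal (hz : Function.Injective z) (i : Fin n) :
    ∃ e : ℂ, ∀ (a : ℂ) (b : Fin n → ℂ), (derivative (nodal z a b)).eval (z i) =
      (a + e * b i + ∑ j, b j / (z i - z j)) * ∏ l ∈ Finset.univ.erase i, (z i - z l) := by
  set π := ∏ l ∈ Finset.univ.erase i, (z i - z l) with hπ
  have hπ0 : π ≠ 0 := Finset.prod_ne_zero_iff.2 fun l hl =>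
    sub_ne_zero.2 fun h => (Finset.ne_of_mem_erase hl).symm (hz h)
  refine ⟨(derivative (∏ l ∈ Finset.univ.erase i, (X - C (z l)))).eval (z i) / π, fun a b => ?_⟩
  have h1 : ∀ s : Finset (Fin n), i ∈ s → (derivative (∏ l ∈ s, (X - C (z l)))).eval (z i) =
      ∏ l ∈ s.erase i, (z i - z l) := by
    intro s hs
    rw [← Finset.mul_prod_erase s _ hs, derivative_mul]
    simp [eval_prod]
  have h2 : ∀ j ∈ Finset.univ.erase i,
      (derivative (∏ l ∈ Finset.univ.erase j, (X - C (z l)))).eval (z i) = π / (z i - z j) := by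
    intro j hj
    have hji := Finset.ne_of_mem_erase hj
    rw [h1 _ (Finset.mem_erase.2 ⟨hji.symm, Finset.mem_univ i⟩),
      eq_div_iff (sub_ne_zero.2 fun h => hji.symm (hz h)), Finset.erase_right_comm,
      Finset.prod_erase_mul _ _ hj]
  simp only [nodal, derivative_add, derivative_sum, derivative_C_mul, eval_add, eval_finsetSum,
    eval_C_mul]
  rw [h1 _ (Finset.mem_univ i), ← hπ, ← Finset.add_sum_erase _ _ (Finset.mem_univ i),
    ← Finset.add_sum_erase _ (fun j => b j / (z i - z j)) (Finset.mem_univ i), sub_self, div_zero,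
    zero_add, Finset.sum_congr rfl fun j hj => by rw [h2 j hj], add_mul, Finset.sum_mul,
    ← add_assoc, add_mul]
  congr 1
  · field_simp
  · exact Finset.sum_congr rfl fun j _ => by ring

theorem coeff_prod_X_sub_C (z : Fin n → ℂ) (s : Finset (Fin n)) :
    (∏ i ∈ s, (X - C (z i))).coeff s.card = 1 := by
  have := coeff_prod_sum s (fun i => X - C (z i)) (fun _ => 1) fun i _ => (natDegree_X_sub_C _).le
  simpa using this

theorem eq_nodal (hz : Function.Injective z) {f : ℂ[X]} (hf : f.natDegree ≤ n) :
    f = nodal z (f.coeff n)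
      fun i => f.eval (z i) / ∏ l ∈ Finset.univ.erase i, (z i - z l) := by
  have hd : ∀ s : Finset (Fin n), (∏ l ∈ s, (X - C (z l))).natDegree = s.card := by
    intro s
    rw [natDegree_prod_of_monic _ _ fun l _ => monic_X_sub_C _]
    simp
  refine eq_of_degree_sub_lt_of_eval_index_eq (Finset.univ) (v := z) hz.injOn ?_ ?_
  · rw [Finset.card_univ, Fintype.card_fin, degree_lt_iff_coeff_zero]
    have hn : ∀ j ∈ (Finset.univ : Finset (Fin n)), ∀ m, n ≤ m →
        (∏ l ∈ Finset.univ.erase j, (X - C (z l))).coeff m = 0 := by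
      intro j _ m hm
      apply coeff_eq_zero_of_natDegree_lt
      rw [hd]
      have := Finset.card_erase_lt_of_mem (Finset.mem_univ j)
      rw [Finset.card_univ, Fintype.card_fin] at this
      omega
    intro m hm
    rw [coeff_sub, nodal, coeff_add, coeff_C_mul, finsetSum_coeff, Finset.sum_eq_zero, add_zero]
    · rcases hm.eq_or_lt with rfl | hm
      · have := coeff_prod_X_sub_C z Finset.univ
        rw [Finset.card_univ, Fintype.card_fin] at this
        rw [this]
        ring
      · have h2 : (∏ i, (X - C (z i))).coeff m = 0 :=
          coeff_eq_zero_of_natDegree_lt (by rw [hd]; simpa using hm)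
        rw [coeff_eq_zero_of_natDegree_lt (hf.trans_lt hm), h2]
        ring
    · intro j hj
      rw [coeff_C_mul, hn j hj m hm, mul_zero]
  · intro i _
    rw [eval_nodal_self, div_mul_cancel₀]
    exact Finset.prod_ne_zero_iff.2 fun l hl =>
      sub_ne_zero.2 fun h => (Finset.ne_of_mem_erase hl).symm (hz h)

end Nodal

theorem exists_eq_prod_of_squarefree {P : ℂ[X]} (hP : Squarefree P) {n : ℕ}
    (hn : P.natDegree = n) :
    ∃ z : Fin n → ℂ, Function.Injective z ∧
      P = C P.leadingCoeff * ∏ i, (X - C (z i)) := by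
  have h1 : P.roots.Nodup := nodup_roots (PerfectField.separable_iff_squarefree.2 hP)
  have h2 : Multiset.card P.roots = n := by
    rw [← hn, (IsAlgClosed.splits P).natDegree_eq_card_roots]
  have h3 : P.roots.toFinset.card = n := by
    rw [← h2, Multiset.toFinset_card_of_nodup h1]
  let e := (P.roots.toFinset.equivFinOfCardEq h3).symm
  refine ⟨fun i => e i, fun i j h => e.injective (Subtype.ext h), ?_⟩
  have h4 := (IsAlgClosed.splits P).eq_prod_roots
  conv_lhs => rw [h4]
  congr 1
  rw [Equiv.prod_comp e fun a => X - C (a : ℂ), Finset.prod_coe_sort P.roots.toFinset fun a => X - C a,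
    Finset.prod_multiset_map_count, Finset.prod_congr rfl]
  intro a ha
  rw [Multiset.count_eq_one_of_mem h1 (Multiset.mem_toFinset.1 ha), pow_one]

/-- The generic case: the Wronskian with one additional exponential is an eigenvalue of the
Calogero–Moser matrix. -/
theorem exists_antisymMatrix_mulVec_eq (μ : Fin N → ℂ) (p : Fin N → ℂ[X]) {n : ℕ}
    (hn : ∑ i, (p i).natDegree = n) (hdeg : (wr μ p).natDegree = n)
    (hsq : Squarefree (wr μ p)) :
    ∃ z : Fin n → ℂ, wr μ p = C (wr μ p).leadingCoeff * ∏ i, (X - C (z i)) ∧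
    ∃ (ν : Fin n → ℂ) (v : Perm (Fin n) → ℂ), v ≠ 0 ∧ (∀ i, ∏ a, (ν i - μ a) = 0) ∧
      ∀ x u w, (wr μ p).leadingCoeff * (∏ a, (u - μ a)) *
        (Cherednik.antisymMatrix 1 z ν x u).mulVec v w = (∏ i, (u - ν i)) *
          (wr (Fin.snoc μ u : Fin (N + 1) → ℂ)
            (Fin.snoc p 1 : Fin (N + 1) → ℂ[X])).eval x * v w := by
  obtain ⟨z, hz, hPz⟩ := exists_eq_prod_of_squarefree hsq hdeg
  obtain ⟨L, hL⟩ : ∃ L, L = (wr μ p).leadingCoeff := ⟨_, rfl⟩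
  have hP0 : L ≠ 0 := hL ▸ leadingCoeff_ne_zero.2 hsq.ne_zero
  rw [← hL] at hPz ⊢
  let π : Fin n → ℂ := fun i => ∏ l ∈ Finset.univ.erase i, (z i - z l)
  have hπ0 : ∀ i, π i ≠ 0 := fun i => Finset.prod_ne_zero_iff.2 fun l hl =>
    sub_ne_zero.2 fun h => (Finset.ne_of_mem_erase hl).symm (hz h)
  let Q : ℂ → ℂ[X] := fun u =>
    wr (Fin.snoc μ u : Fin (N + 1) → ℂ) (Fin.snoc p 1 : Fin (N + 1) → ℂ[X])
  have hd : ∀ u : ℂ, ∀ i, ((Fin.snoc p 1 : Fin (N + 1) → ℂ[X]) i).natDegree ≤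
      (Fin.snoc (fun i => (p i).natDegree) 0 : Fin (N + 1) → ℕ) i := by
    intro u i
    induction i using Fin.lastCases <;> simp
  have hsum : ∑ i, (Fin.snoc (fun i => (p i).natDegree) 0 : Fin (N + 1) → ℕ) i = n := by
    rw [Fin.sum_univ_castSucc]
    simpa using hn
  have hQdeg : ∀ u, (Q u).natDegree ≤ n := fun u => by
    have := natDegree_wr_le (Fin.snoc μ u : Fin (N + 1) → ℂ) _ _ (hd u)
    rwa [hsum] at this
  have hQcoeff : ∀ u, (Q u).coeff n = L * ∏ a, (u - μ a) := fun u => by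
    have h1 := coeff_wr (Fin.snoc μ u : Fin (N + 1) → ℂ) _ _ (hd u)
    have h2 := coeff_wr μ p _ fun i => le_rfl
    rw [hn] at h2
    rw [hsum, det_vandermonde_snoc, Fin.prod_univ_castSucc] at h1
    simp only [Fin.snoc_castSucc, Fin.snoc_last, coeff_one_zero, mul_one] at h1
    rw [h1, hL, leadingCoeff, hdeg, h2]
    ring
  have hroot : ∀ i, (wr μ p).eval (z i) = 0 := fun i => by
    rw [hPz, eval_mul, eval_prod, Finset.prod_eq_zero (Finset.mem_univ i) (by simp), mul_zero]
  have hder : ∀ i, (derivative (wr μ p)).eval (z i) ≠ 0 := fun i =>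
    (PerfectField.separable_iff_squarefree.2 hsq).eval₂_derivative_ne_zero (RingHom.id ℂ) (hroot i)
  choose t ht using fun i => exists_derivative_wr_snoc_eval μ p (hroot i) (hder i)
  choose e he using fun i => exists_eval_derivative_nodal hz i
  let r : Fin n → ℂ[X] := fun i =>
    C (1 / (L * π i)) * ∑ k : Fin (N + 1), C ((cof μ p k).eval (z i)) * X ^ (k : ℕ)
  have hr : ∀ i u, (r i).eval u = (Q u).eval (z i) / (L * π i) := by
    intro i u
    simp only [r, Q, wr_snoc_one, eval_mul, eval_C, eval_finsetSum, eval_pow, eval_X]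
    ring
  have hQ : ∀ u, Q u = nodal z (L * ∏ a, (u - μ a)) fun i => L * (r i).eval u := by
    intro u
    rw [eq_nodal hz (hQdeg u), hQcoeff]
    congr 1
    ext i
    have h1 := hπ0 i
    rw [hr]
    change _ / π i = _
    field_simp
  refine ⟨z, hPz, ?_⟩
  obtain ⟨ν, v, hv, hν, hB⟩ := Cherednik.exists_antisymMatrix_mulVec (fun i => t i - e i) hz
    (∏ a, (X - C (μ a))) r (by
      intro i u
      have h1 := ht i u
      change (derivative (Q u)).eval (z i) = (t i - u) * (Q u).eval (z i) at h1
      rw [hQ, he, eval_nodal_self] at h1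
      have h2 : L * π i ≠ 0 := mul_ne_zero hP0 (hπ0 i)
      apply mul_left_cancel₀ h2
      simp only [eval_prod, eval_sub, eval_X, eval_C]
      simp only [mul_div_assoc, ← Finset.mul_sum] at h1
      linear_combination h1)
  refine ⟨ν, v, hv, fun i => by simpa [IsRoot.def, eval_prod] using hν i, fun x u w => ?_⟩
  have h1 := hB x u w
  simp only [eval_prod, eval_sub, eval_X, eval_C] at h1
  change _ = _ * (Q u).eval x * _
  rw [hQ, eval_nodal, mul_assoc L, h1]
  simp only [mul_assoc L, ← Finset.mul_sum]
  ring

theorem squarefree_iff_eval {f : ℂ[X]} :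
    Squarefree f ↔ ∀ x, f.eval x = 0 → (derivative f).eval x ≠ 0 := by
  rw [← PerfectField.separable_iff_squarefree, Polynomial.Separable,
    Polynomial.isCoprime_iff_aeval_ne_zero_of_isAlgClosed ℂ ℂ]
  simp only [coe_aeval_eq_eval, imp_iff_not_or]

theorem finite_not_squarefree_add_C_mul {A : ℂ[X]} (hA : Squarefree A) (B : ℂ[X]) :
    {e : ℂ | ¬ Squarefree (A + C e * B)}.Finite := by
  rw [squarefree_iff_eval] at hA
  by_cases hD : derivative A * B - A * derivative B = 0
  · obtain ⟨b, rfl⟩ : A ∣ B := by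
      have h1 : IsCoprime A (derivative A) :=
        PerfectField.separable_iff_squarefree.2 (squarefree_iff_eval.2 hA)
      exact h1.dvd_of_dvd_mul_left ⟨derivative B, sub_eq_zero.1 hD⟩
    have hA0 : A ≠ 0 := by
      rintro rfl
      simp at hA
    have hb : derivative b = 0 := by
      have : A * A * derivative b = 0 := by
        rw [derivative_mul] at hD
        linear_combination -hD
      simpa [hA0] using this
    obtain ⟨c, rfl⟩ := natDegree_eq_zero.1 (derivative_eq_zero.1 hb)
    refine (Set.finite_singleton (-c⁻¹)).subset fun e he => ?_
    by_contra h
    refine he (squarefree_iff_eval.2 ?_)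
    have h1 : 1 + e * c ≠ 0 := by
      intro h2
      have hc : c ≠ 0 := by
        rintro rfl
        simp at h2
      apply h
      rw [Set.mem_singleton_iff]
      field_simp
      linear_combination h2
    have h2 : A + C e * (A * C c) = C (1 + e * c) * A := by
      simp only [C_add, C_mul, C_1]
      ring
    intro x hx
    rw [h2, eval_C_mul] at hx
    rw [h2, derivative_C_mul, eval_C_mul]
    exact mul_ne_zero h1 (hA x ((mul_eq_zero.1 hx).resolve_left h1))
  · have hfin := (derivative A * B - A * derivative B).roots.toFinset.finite_toSet
    refine ((hfin.image fun x => -A.eval x / B.eval x).union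
      (hfin.image fun x => -(derivative A).eval x / (derivative B).eval x)).subset fun e he => ?_
    rw [Set.mem_ofPred_eq, squarefree_iff_eval] at he
    push Not at he
    obtain ⟨x, hx, hx'⟩ := he
    simp only [derivative_add, derivative_C_mul, eval_add, eval_C_mul] at hx hx'
    have hxD : x ∈ (↑(derivative A * B - A * derivative B).roots.toFinset : Set ℂ) := by
      simp only [Finset.mem_coe, Multiset.mem_toFinset, mem_roots hD, IsRoot.def, eval_sub,
        eval_mul]
      linear_combination eval x B * hx' - eval x (derivative B) * hx
    by_cases hB : B.eval x = 0
    · rw [hB, mul_zero, add_zero] at hx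
      have h1 := hA x hx
      have h2 : (derivative B).eval x ≠ 0 := by
        intro h
        rw [h, mul_zero, add_zero] at hx'
        exact h1 hx'
      right
      refine ⟨x, hxD, ?_⟩
      field_simp
      linear_combination -hx'
    · left
      refine ⟨x, hxD, ?_⟩
      field_simp
      linear_combination -hx

theorem jets_update (μ : Fin N → ℂ) (p : Fin N → ℂ[X]) (a : Fin N) (f : ℂ[X]) :
    jets μ (Function.update p a f) =
      (jets μ p).updateCol a fun i => (twist (μ a) ^ (i : ℕ)) f := by
  ext1 i j
  rw [Matrix.updateCol_apply, jets, Matrix.of_apply]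
  split_ifs with h
  · subst h
    simp
  · simp [h, jets]

theorem wr_update_add_C_mul (μ : Fin N → ℂ) (p : Fin N → ℂ[X]) (a : Fin N) (f g : ℂ[X]) (e : ℂ) :
    wr μ (Function.update p a (f + C e * g)) =
      wr μ (Function.update p a f) + C e * wr μ (Function.update p a g) := by
  have h : (fun i : Fin N => (twist (μ a) ^ (i : ℕ)) (f + C e * g)) =
      (fun i : Fin N => (twist (μ a) ^ (i : ℕ)) f) +
        C e • fun i : Fin N => (twist (μ a) ^ (i : ℕ)) g := by
    ext1 i
    rw [← smul_eq_C_mul, map_add, map_smul, Pi.add_apply, Pi.smul_apply, smul_eq_mul,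
      ← smul_eq_C_mul]
  rw [wr, jets_update, h, Matrix.det_updateCol_add, Matrix.det_updateCol_smul, ← jets_update,
    ← jets_update, wr, wr]

theorem wr_C_mul (μ : Fin N → ℂ) (c : Fin N → ℂ) (p : Fin N → ℂ[X]) :
    wr μ (fun a => C (c a) * p a) = C (∏ a, c a) * wr μ p := by
  rw [map_prod, wr, wr, ← Matrix.det_mul_row]
  congr 1
  ext1 i j
  simp only [jets, Matrix.of_apply]
  rw [← smul_eq_C_mul, map_smul, smul_eq_C_mul]

theorem exists_injective_near (μ : Fin N → ℂ) {r : ℝ} (hr : 0 < r) :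
    ∃ μ' : Fin N → ℂ, Function.Injective μ' ∧ ∀ a, ‖μ' a - μ a‖ < r := by
  have hfin : {t : ℝ | ¬ Function.Injective fun a => μ a + t * ((a : ℕ) : ℂ)}.Finite := by
    refine ((Set.finite_range fun ij : Fin N × Fin N =>
      (μ ij.1 - μ ij.2) / (((ij.2 : ℕ) : ℂ) - ((ij.1 : ℕ) : ℂ))).preimage
        (f := ((↑) : ℝ → ℂ)) Complex.ofReal_injective.injOn).subset fun t ht => ?_
    simp only [Set.mem_ofPred_eq, Function.Injective] at ht
    push Not at ht
    obtain ⟨i, j, hij, hne⟩ := ht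
    refine ⟨(i, j), ?_⟩
    have : ((j : ℕ) : ℂ) - ((i : ℕ) : ℂ) ≠ 0 := by
      rw [sub_ne_zero, Ne, Nat.cast_inj]
      exact fun h => hne (Fin.ext h.symm)
    field_simp
    linear_combination hij
  have hinf : (Set.Ioo 0 (r / (N + 1))).Infinite := Set.Ioo_infinite (by positivity)
  obtain ⟨t, ht, ht'⟩ := (hinf.sdiff hfin).nonempty
  refine ⟨_, not_not.1 ht', fun a => ?_⟩
  rw [add_sub_cancel_left, norm_mul, Complex.norm_real, Complex.norm_natCast,
    Real.norm_of_nonneg ht.1.le]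
  have h1 : ((a : ℕ) : ℝ) ≤ N + 1 := by
    have := a.2
    exact_mod_cast (by omega : (a : ℕ) ≤ N + 1)
  calc t * (a : ℕ) ≤ t * (N + 1) := mul_le_mul_of_nonneg_left h1 ht.1.le
    _ < r / (N + 1) * (N + 1) := mul_lt_mul_of_pos_right ht.2 (by positivity)
    _ = r := div_mul_cancel₀ _ (by positivity)

/-- A Wronskian becomes squarefree after a small perturbation of the exponents and of the
constant terms. -/
theorem exists_squarefree_near (μ : Fin N → ℂ) (p : Fin N → ℂ[X]) {r : ℝ} (hr : 0 < r) :
    ∃ μ' δ : Fin N → ℂ, Function.Injective μ' ∧ (∀ a, ‖μ' a - μ a‖ < r) ∧ (∀ a, ‖δ a‖ < r) ∧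
      Squarefree (wr μ' fun a => p a + C (δ a)) := by
  obtain ⟨μ', hμ', hμ'r⟩ := exists_injective_near μ hr
  have key : ∀ s : Finset (Fin N), ∃ e : Fin N → ℂ, (∀ a, r⁻¹ < ‖e a‖) ∧
      Squarefree (wr μ' fun a => if a ∈ s then 1 + C (e a) * p a else 1) := by
    intro s
    induction s using Finset.induction_on with
    | empty =>
      refine ⟨fun _ => ((r⁻¹ + 1 : ℝ) : ℂ), fun a => ?_, ?_⟩
      · rw [Complex.norm_real, Real.norm_of_nonneg (by positivity)]
        linarith
      · simp only [Finset.notMem_empty, if_false]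
        apply IsUnit.squarefree
        have h1 := coeff_wr μ' (fun _ => 1) (fun _ => 0) fun i => by simp
        have h2 := natDegree_wr_le μ' (fun _ => 1) (fun _ => 0) fun i => by simp
        simp only [Finset.sum_const_zero, coeff_one_zero, Finset.prod_const_one, mul_one] at h1 h2
        rw [eq_C_of_natDegree_le_zero h2, h1]
        exact isUnit_C.2 (isUnit_iff_ne_zero.2 (Matrix.det_vandermonde_ne_zero_iff.2 hμ'))
    | insert b s hb ih =>
      obtain ⟨e, he, hsq⟩ := ih
      let f : Fin N → ℂ[X] := fun a => if a ∈ s then 1 + C (e a) * p a else 1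
      have hfin := (finite_not_squarefree_add_C_mul hsq
        (wr μ' (Function.update f b (p b)))).preimage
          (f := ((↑) : ℝ → ℂ)) Complex.ofReal_injective.injOn
      obtain ⟨t, ht, ht'⟩ := ((Set.Ioi_infinite (r⁻¹)).sdiff hfin).nonempty
      refine ⟨Function.update e b t, fun a => ?_, ?_⟩
      · rcases eq_or_ne a b with rfl | hab
        · rw [Function.update_self, Complex.norm_real]
          exact lt_of_lt_of_le ht (le_abs_self _)
        · rw [Function.update_of_ne hab]
          exact he a
      · convert not_not.1 ht' using 1
        have h1 : f = Function.update f b 1 := by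
          simp [f, hb]
        change _ = wr μ' f + _
        nth_rw 1 [h1]
        rw [← wr_update_add_C_mul]
        congr 1
        ext1 a
        rcases eq_or_ne a b with rfl | hab
        · simp
        · simp [hab, f]
  obtain ⟨e, he, hsq⟩ := key Finset.univ
  have he0 : ∀ a, e a ≠ 0 := fun a => norm_pos_iff.1 ((inv_pos.2 hr).trans (he a))
  refine ⟨μ', fun a => (e a)⁻¹, hμ', hμ'r, fun a => ?_, hsq.squarefree_of_dvd ?_⟩
  · rw [norm_inv]
    exact inv_lt_of_inv_lt₀ hr (he a)
  · have h : (fun a => if a ∈ Finset.univ then 1 + C (e a) * p a else 1) =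
        fun a => C (e a) * (p a + C (e a)⁻¹) := by
      ext1 a
      rw [if_pos (Finset.mem_univ a), mul_add, ← C_mul, mul_inv_cancel₀ (he0 a), C_1, add_comm]
    rw [h, wr_C_mul]
    exact dvd_mul_left _ _

theorem natDegree_wr_of_injective {μ : Fin N → ℂ} (hμ : Function.Injective μ) {p : Fin N → ℂ[X]}
    (hp : wr μ p ≠ 0) : (wr μ p).natDegree = ∑ i, (p i).natDegree := by
  have hp0 : ∀ i, p i ≠ 0 := by
    intro i hi
    apply hp
    refine Matrix.det_eq_zero_of_column_eq_zero i fun k => ?_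
    simp [jets, hi]
  refine natDegree_eq_of_le_of_coeff_ne_zero (natDegree_wr_le μ p _ fun i => le_rfl) ?_
  rw [coeff_wr μ p _ fun i => le_rfl]
  exact mul_ne_zero (Matrix.det_vandermonde_ne_zero_iff.2 hμ)
    (Finset.prod_ne_zero_iff.2 fun i _ => leadingCoeff_ne_zero.2 (hp0 i))

theorem continuous_twist_pow_eval (k : ℕ) (f : ℂ[X]) (x : ℂ) :
    Continuous fun c : ℂ => ((twist c ^ k) f).eval x := by
  induction k generalizing f with
  | zero => simpa using continuous_const
  | succ k ih =>
    simp only [pow_succ, Module.End.mul_apply, twist_apply, map_add, map_smul, eval_add, eval_smul,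
      smul_eq_mul]
    exact (ih _).add (continuous_id.mul (ih _))

theorem continuous_wr_eval {T : Type*} [TopologicalSpace T] {m d : T → Fin N → ℂ}
    (hm : Continuous m) (hd : Continuous d) (p : Fin N → ℂ[X]) (x : ℂ) :
    Continuous fun t => (wr (m t) fun a => p a + C (d t a)).eval x := by
  have h : ∀ t, (wr (m t) fun a => p a + C (d t a)).eval x =
      (Matrix.of fun i j : Fin N => ((twist (m t j) ^ (i : ℕ)) (p j)).eval x +
        d t j * m t j ^ (i : ℕ)).det := by
    intro t
    rw [wr, ← coe_evalRingHom, RingHom.map_det]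
    congr 1
    ext1 i j
    simp only [jets, RingHom.mapMatrix_apply, Matrix.map_apply, Matrix.of_apply, map_add,
      coe_evalRingHom, eval_add]
    congr 1
    rw [← mul_one (C (d t j)), ← smul_eq_C_mul, map_smul, twist_pow_one, eval_smul, eval_C,
      smul_eq_mul]
  simp only [h]
  refine Continuous.matrix_det (continuous_matrix fun i j => ?_)
  have h1 : Continuous fun t => m t j := (continuous_apply j).comp hm
  have h2 : Continuous fun t => d t j := (continuous_apply j).comp hd
  exact ((continuous_twist_pow_eval i (p j) x).comp h1).add (h2.mul (h1.pow i))

theorem continuous_wr_snoc_eval {T : Type*} [TopologicalSpace T] {m d : T → Fin N → ℂ}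
    (hm : Continuous m) (hd : Continuous d) (p : Fin N → ℂ[X]) (u x : ℂ) :
    Continuous fun t => (wr (Fin.snoc (m t) u : Fin (N + 1) → ℂ)
      (Fin.snoc (fun a => p a + C (d t a)) 1 : Fin (N + 1) → ℂ[X])).eval x := by
  have h : ∀ t, (Fin.snoc (fun a => p a + C (d t a)) 1 : Fin (N + 1) → ℂ[X]) =
      fun a => (Fin.snoc p 1 : Fin (N + 1) → ℂ[X]) a +
        C ((Fin.snoc (d t) 0 : Fin (N + 1) → ℂ) a) := by
    intro t
    ext1 a
    induction a using Fin.lastCases <;> simp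
  simp only [h]
  refine continuous_wr_eval (continuous_pi fun a => ?_) (continuous_pi fun a => ?_) _ x
  · induction a using Fin.lastCases with
    | last => simpa using continuous_const
    | cast a => simpa [Function.comp_def] using (continuous_apply a).comp hm
  · induction a using Fin.lastCases with
    | last => simpa using continuous_const
    | cast a => simpa [Function.comp_def] using (continuous_apply a).comp hd

theorem continuous_antisymMatrix_mulVec {n : ℕ} {T : Type*} [TopologicalSpace T]
    {g h ν : T → Fin n → ℂ} {v : T → Perm (Fin n) → ℂ} (hg : Continuous g) (hh : Continuous h)
    (hν : Continuous ν) (hv : Continuous v) (x u : ℂ) (w : Perm (Fin n)) :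
    Continuous fun t => (Cherednik.antisymMatrix (g t) (h t) (ν t) x u).mulVec (v t) w := by
  simp only [Matrix.mulVec, dotProduct, Cherednik.antisymMatrix, Matrix.of_apply]
  fun_prop

/-- The joint spectral data of a degenerate Calogero–Moser matrix attached to a Wronskian, where
the roots of the Wronskian are `h i / g i` in projective coordinates. -/
structure IsSpectralData {n : ℕ} (μ : Fin N → ℂ) (p : Fin N → ℂ[X]) (g h ν : Fin n → ℂ)
    (v : Perm (Fin n) → ℂ) : Prop where
  normalized : ∀ i, g i = 1 ∨ h i = 1
  norm_eq_one : ‖v‖ = 1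
  root : ∀ i, ∏ a, (ν i - μ a) = 0
  wr_mul : ∀ x y, (wr μ p).eval x * ∏ i, (g i * y - h i) = (wr μ p).eval y * ∏ i, (g i * x - h i)
  mulVec : ∀ x y u w, (wr μ p).eval y * (∏ a, (u - μ a)) *
    (Cherednik.antisymMatrix g h ν x u).mulVec v w =
      (∏ i, (g i * y - h i)) * (∏ i, (u - ν i)) *
        (wr (Fin.snoc μ u : Fin (N + 1) → ℂ) (Fin.snoc p 1 : Fin (N + 1) → ℂ[X])).eval x * v w

theorem isSpectralData_iff {n : ℕ} {μ : Fin N → ℂ} {p : Fin N → ℂ[X]} {g h ν : Fin n → ℂ}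
    {v : Perm (Fin n) → ℂ} : IsSpectralData μ p g h ν v ↔ (∀ i, g i = 1 ∨ h i = 1) ∧ ‖v‖ = 1 ∧
      (∀ i, ∏ a, (ν i - μ a) = 0) ∧
      (∀ x y, (wr μ p).eval x * ∏ i, (g i * y - h i) =
        (wr μ p).eval y * ∏ i, (g i * x - h i)) ∧
      ∀ x y u w, (wr μ p).eval y * (∏ a, (u - μ a)) *
        (Cherednik.antisymMatrix g h ν x u).mulVec v w =
          (∏ i, (g i * y - h i)) * (∏ i, (u - ν i)) *
            (wr (Fin.snoc μ u : Fin (N + 1) → ℂ)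
              (Fin.snoc p 1 : Fin (N + 1) → ℂ[X])).eval x * v w :=
  ⟨fun h => ⟨h.1, h.2, h.3, h.4, h.5⟩, fun ⟨h1, h2, h3, h4, h5⟩ => ⟨h1, h2, h3, h4, h5⟩⟩

theorem exists_isSpectralData_of_squarefree {n : ℕ} {μ : Fin N → ℂ} (hμ : Function.Injective μ)
    {p : Fin N → ℂ[X]} (hn : ∑ i, (p i).natDegree = n) (hsq : Squarefree (wr μ p)) :
    ∃ (g h ν : Fin n → ℂ) (v : Perm (Fin n) → ℂ), IsSpectralData μ p g h ν v ∧
      (∀ i, ‖g i‖ ≤ 1) ∧ ∀ i, ‖h i‖ ≤ 1 := by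
  obtain ⟨z, hz, ν, v, hv, hν, hM⟩ := exists_antisymMatrix_mulVec_eq μ p hn
    ((natDegree_wr_of_injective hμ hsq.ne_zero).trans hn) hsq
  generalize (wr μ p).leadingCoeff = L at hz hM
  let g : Fin n → ℂ := fun i => if ‖z i‖ ≤ 1 then 1 else (z i)⁻¹
  have hg : ∀ i, (g i = 1 ∨ (g * z) i = 1) ∧ ‖g i‖ ≤ 1 ∧ ‖(g * z) i‖ ≤ 1 := by
    intro i
    by_cases h : ‖z i‖ ≤ 1
    · simp [g, h]
    · have h1 : 1 ≤ ‖z i‖ := (not_le.1 h).le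
      have h0 : z i ≠ 0 := norm_pos_iff.1 (zero_lt_one.trans_le h1)
      simp [g, h, h0, inv_le_one_of_one_le₀ h1]
  have hprod : ∀ x, ∏ i, (g i * x - (g * z) i) = (∏ i, g i) * ∏ i, (x - z i) := by
    intro x
    rw [← Finset.prod_mul_distrib]
    exact Finset.prod_congr rfl fun i _ => by rw [Pi.mul_apply]; ring
  have heval : ∀ x, (wr μ p).eval x = L * ∏ i, (x - z i) := by
    intro x
    rw [hz]
    simp [eval_prod]
  have hv' : (‖v‖ : ℂ) ≠ 0 := Complex.ofReal_ne_zero.2 (norm_ne_zero_iff.2 hv)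
  refine ⟨g, g * z, ν, (‖v‖ : ℂ)⁻¹ • v, ⟨fun i => (hg i).1, ?_, hν, fun x y => ?_,
    fun x y u w => ?_⟩, fun i => (hg i).2.1, fun i => (hg i).2.2⟩
  · rw [norm_smul, norm_inv, Complex.norm_real, norm_norm,
      inv_mul_cancel₀ (norm_ne_zero_iff.2 hv)]
  · rw [hprod, hprod, heval, heval]
    ring
  · rw [Cherednik.antisymMatrix_smul, Matrix.mulVec_smul, Matrix.smul_mulVec, hprod, heval]
    simp only [Pi.smul_apply, smul_eq_mul]
    linear_combination (‖v‖ : ℂ)⁻¹ * (∏ i, g i) * (∏ i, (y - z i)) * hM x u w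

theorem isClosed_isSpectralData {n : ℕ} (p : Fin N → ℂ[X]) :
    IsClosed {t : ((Fin N → ℂ) × (Fin N → ℂ)) ×
      ((Fin n → ℂ) × (Fin n → ℂ)) × (Fin n → ℂ) × (Perm (Fin n) → ℂ) |
        IsSpectralData t.1.1 (fun a => p a + C (t.1.2 a)) t.2.1.1 t.2.1.2 t.2.2.1 t.2.2.2} := by
  simp only [isSpectralData_iff, Set.ofPred_and, Set.ofPred_forall, Set.ofPred_or]
  refine (isClosed_iInter fun i => ?_).inter (IsClosed.inter ?_ (IsClosed.inter
    (isClosed_iInter fun i => ?_) (IsClosed.inter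
    (isClosed_iInter fun x => isClosed_iInter fun y => ?_)
    (isClosed_iInter fun x => isClosed_iInter fun y => isClosed_iInter fun u =>
      isClosed_iInter fun w => ?_))))
  · exact (isClosed_eq (by fun_prop) continuous_const).union
      (isClosed_eq (by fun_prop) continuous_const)
  · exact isClosed_eq (by fun_prop) continuous_const
  · exact isClosed_eq (by fun_prop) continuous_const
  · refine isClosed_eq ((continuous_wr_eval ?_ ?_ p x).mul ?_)
      ((continuous_wr_eval ?_ ?_ p y).mul ?_) <;> fun_prop
  · refine isClosed_eq (((continuous_wr_eval ?_ ?_ p y).mul ?_).mul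
      (continuous_antisymMatrix_mulVec ?_ ?_ ?_ ?_ x u w))
      ((Continuous.mul ?_ (continuous_wr_snoc_eval ?_ ?_ p u x)).mul ?_) <;> fun_prop

theorem exists_isSpectralData (μ : Fin N → ℂ) (p : Fin N → ℂ[X]) {n : ℕ}
    (hn : ∑ i, (p i).natDegree = n) :
    ∃ (g h ν : Fin n → ℂ) (v : Perm (Fin n) → ℂ), IsSpectralData μ p g h ν v := by
  have hr : ∀ k : ℕ, (0 : ℝ) < 1 / (k + 1) := fun k => by positivity
  choose μ' δ hinj hμ' hδ hsq using fun k => exists_squarefree_near μ p (hr k)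
  have hn' : ∀ k, ∑ i, (p i + C (δ k i)).natDegree = n := fun k => by simpa using hn
  choose g h ν v hs hg hh using fun k => exists_isSpectralData_of_squarefree (hinj k) (hn' k) (hsq k)
  have hlim : ∀ {a : ℕ → Fin N → ℂ} {b : Fin N → ℂ}, (∀ k i, ‖a k i - b i‖ < 1 / ((k : ℝ) + 1)) →
      Filter.Tendsto a Filter.atTop (nhds b) := by
    intro a b hab
    refine tendsto_pi_nhds.2 fun i => tendsto_iff_norm_sub_tendsto_zero.2 ?_
    exact squeeze_zero (fun k => norm_nonneg _) (fun k => (hab k i).le)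
      tendsto_one_div_add_atTop_nhds_zero_nat
  have hμlim := hlim hμ'
  have hδlim : Filter.Tendsto δ Filter.atTop (nhds 0) := hlim (by simpa using hδ)
  have hνb : ∀ k i, ‖ν k i‖ ≤ ‖μ‖ + 1 := by
    intro k i
    obtain ⟨a, -, ha⟩ := Finset.prod_eq_zero_iff.1 ((hs k).root i)
    rw [sub_eq_zero.1 ha]
    have h1 : ‖μ' k a - μ a‖ ≤ 1 := (hμ' k a).le.trans (by
      rw [div_le_one (by positivity)]
      linarith [(Nat.cast_nonneg k : (0 : ℝ) ≤ k)])
    calc ‖μ' k a‖ ≤ ‖μ a‖ + ‖μ' k a - μ a‖ := norm_le_norm_add_norm_sub' _ _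
      _ ≤ ‖μ‖ + 1 := add_le_add (norm_le_pi_norm μ a) h1
  let t : ℕ → ((Fin n → ℂ) × (Fin n → ℂ)) × (Fin n → ℂ) × (Perm (Fin n) → ℂ) :=
    fun k => ((g k, h k), ν k, v k)
  have ht : ∀ k, t k ∈ Metric.closedBall 0 (‖μ‖ + 1) := by
    intro k
    have h0 : 0 ≤ ‖μ‖ + 1 := by positivity
    have h1 : 1 ≤ ‖μ‖ + 1 := by linarith [norm_nonneg μ]
    rw [mem_closedBall_zero_iff]
    simp only [t, Prod.norm_def, max_le_iff]
    exact ⟨⟨(pi_norm_le_iff_of_nonneg h0).2 fun i => (hg k i).trans h1,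
      (pi_norm_le_iff_of_nonneg h0).2 fun i => (hh k i).trans h1⟩,
      (pi_norm_le_iff_of_nonneg h0).2 (hνb k), (hs k).norm_eq_one.trans_le h1⟩
  obtain ⟨l, -, φ, hφ, hl⟩ := tendsto_subseq_of_bounded Metric.isBounded_closedBall ht
  have := (isClosed_isSpectralData (n := n) p).mem_of_tendsto
    (((hμlim.comp hφ.tendsto_atTop).prodMk_nhds (hδlim.comp hφ.tendsto_atTop)).prodMk_nhds hl)
    (Filter.Eventually.of_forall fun k => hs (φ k))
  exact ⟨_, _, _, _, by simpa using this⟩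

theorem eval_map_conj_ofReal (f : ℂ[X]) (t : ℝ) :
    (f.map (starRingEnd ℂ)).eval (t : ℂ) = starRingEnd ℂ (f.eval (t : ℂ)) := by
  have := eval₂_at_apply (p := f) (starRingEnd ℂ) (t : ℂ)
  rwa [Complex.conj_ofReal, ← eval_map] at this

theorem eq_of_eval_ofReal_eq {f g : ℂ[X]} {s : Set ℝ} (hs : s.Finite)
    (h : ∀ t : ℝ, t ∉ s → f.eval (t : ℂ) = g.eval (t : ℂ)) : f = g := by
  refine eq_of_infinite_eval_eq f g ((hs.infinite_compl.image
    Complex.ofReal_injective.injOn).mono ?_)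
  rintro _ ⟨t, ht, rfl⟩
  exact h t ht

theorem map_conj_eq_self {f : ℂ[X]} {s : Set ℝ} (hs : s.Finite)
    (h : ∀ t : ℝ, t ∉ s → (f.eval (t : ℂ)).im = 0) : f.map (starRingEnd ℂ) = f :=
  eq_of_eval_ofReal_eq hs fun t ht => by
    rw [eval_map_conj_ofReal, Complex.conj_eq_iff_im.2 (h t ht)]

open scoped ComplexOrder in
/-- If the exponents and the roots of the Wronskian are real, then the differential operator
annihilating the quasipolynomials has real coefficients up to a common factor. -/
theorem exists_map_conj_C_mul_cof (μ : Fin N → ℂ) (p : Fin N → ℂ[X]) (hμ : ∀ a, (μ a).im = 0)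
    (hP : wr μ p ≠ 0) (hroots : ∀ z, (wr μ p).IsRoot z → z.im = 0) :
    ∃ κ : ℂ, κ ≠ 0 ∧ ∀ k, (C κ * cof μ p k).map (starRingEnd ℂ) = C κ * cof μ p k := by
  obtain ⟨g, h, ν, v, hs⟩ := exists_isSpectralData μ p rfl
  let G : ℂ[X] := ∏ i, (C (g i) * X - C (h i))
  have hG : ∀ x, G.eval x = ∏ i, (g i * x - h i) := fun x => by simp [G, eval_prod]
  have hG0 : G ≠ 0 := Finset.prod_ne_zero_iff.2 fun i _ hi => by
    have h0 := congrArg (fun f => f.coeff 0) hi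
    have h1 := congrArg (fun f => f.coeff 1) hi
    simp [coeff_C] at h0 h1
    rcases hs.normalized i with h2 | h2 <;> simp_all
  obtain ⟨y, hy⟩ : ∃ y : ℝ, (wr μ p * G).eval (y : ℂ) ≠ 0 := by
    by_contra! hy
    exact mul_ne_zero hP hG0 (eq_of_eval_ofReal_eq Set.finite_empty fun t _ => by
      rw [hy t, eval_zero])
  rw [eval_mul, hG] at hy
  obtain ⟨hPy, hGy⟩ := mul_ne_zero_iff.1 hy
  have hroot : ∀ x, ∏ i, (g i * x - h i) = 0 → x.im = 0 := fun x hx => hroots x <| by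
    have h1 := hs.wr_mul x y
    rw [hx, mul_zero] at h1
    exact (mul_eq_zero.1 h1).resolve_right hGy
  have hgh : ∀ i, (g i).im = 0 ∧ (h i).im = 0 := by
    intro i
    rcases hs.normalized i with h1 | h1
    · refine ⟨by simp [h1], hroot _ (Finset.prod_eq_zero (Finset.mem_univ i) (by simp [h1]))⟩
    · refine ⟨?_, by simp [h1]⟩
      by_cases h2 : g i = 0
      · simp [h2]
      · have h3 := hroot (g i)⁻¹ (Finset.prod_eq_zero (Finset.mem_univ i) (by simp [h1, h2]))
        rw [← Complex.conj_eq_iff_im, map_inv₀, inv_inj] at h3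
        exact Complex.conj_eq_iff_im.1 h3
  have hν : ∀ i, ∃ a, ν i = μ a := fun i => by
    obtain ⟨a, -, ha⟩ := Finset.prod_eq_zero_iff.1 (hs.root i)
    exact ⟨a, sub_eq_zero.1 ha⟩
  have hνim : ∀ i, (ν i).im = 0 := fun i => by
    obtain ⟨a, ha⟩ := hν i
    rw [ha, hμ]
  have him : ∀ {ι : Type} [Fintype ι] (f : ι → ℂ), (∀ i, (f i).im = 0) → (∏ i, f i).im = 0 := by
    intro ι _ f hf
    rw [← Complex.conj_eq_iff_im, map_prod]
    exact Finset.prod_congr rfl fun i _ => Complex.conj_eq_iff_im.2 (hf i)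
  refine ⟨((wr μ p).eval (y : ℂ))⁻¹, inv_ne_zero hPy, ?_⟩
  have hQ : ∀ x u : ℝ, (∀ a, (u : ℂ) ≠ μ a) → (((wr μ p).eval (y : ℂ))⁻¹ *
      (wr (Fin.snoc μ (u : ℂ) : Fin (N + 1) → ℂ)
        (Fin.snoc p 1 : Fin (N + 1) → ℂ[X])).eval (x : ℂ)).im = 0 := by
    intro x u hu
    set Q := (wr (Fin.snoc μ (u : ℂ) : Fin (N + 1) → ℂ)
        (Fin.snoc p 1 : Fin (N + 1) → ℂ[X])).eval (x : ℂ) with hQdef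
    set m := ∏ a, ((u : ℂ) - μ a) with hm
    set c := ∏ i, ((u : ℂ) - ν i) with hc
    set D := ∏ i, (g i * (y : ℂ) - h i) with hD
    have hm0 : m ≠ 0 := Finset.prod_ne_zero_iff.2 fun a _ => sub_ne_zero.2 (hu a)
    have hc0 : c ≠ 0 := Finset.prod_ne_zero_iff.2 fun i _ => by
      obtain ⟨a, ha⟩ := hν i
      rw [ha]
      exact sub_ne_zero.2 (hu a)
    have hmim : m.im = 0 := him _ fun a => by simp [hμ]
    have hcim : c.im = 0 := him _ fun a => by simp [hνim]
    have hDim : D.im = 0 := him _ fun i => by simp [(hgh i).1, (hgh i).2]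
    let M := Cherednik.antisymMatrix g h ν (x : ℂ) (u : ℂ)
    have hM : M.IsHermitian := Cherednik.antisymMatrix_isHermitian (fun i => (hgh i).1)
      (fun i => (hgh i).2) hνim (Complex.ofReal_im x) (Complex.ofReal_im u)
    have h1 : M.mulVec v = (D * c * m⁻¹ * (((wr μ p).eval (y : ℂ))⁻¹ * Q)) • v := by
      ext1 w
      have h2 := hs.mulVec x y u w
      rw [Pi.smul_apply, smul_eq_mul]
      field_simp
      linear_combination h2
    have h2 : (star v ⬝ᵥ M.mulVec v).im = 0 := hM.im_star_dotProduct_mulVec_self v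
    have h3 : (star v ⬝ᵥ v).im = 0 := by
      have := Matrix.isHermitian_one (n := Perm (Fin _)) (α := ℂ)
        |>.im_star_dotProduct_mulVec_self v
      rwa [Matrix.one_mulVec] at this
    have hv : v ≠ 0 := norm_ne_zero_iff.1 (by rw [hs.norm_eq_one]; exact one_ne_zero)
    have h4 : star v ⬝ᵥ v ≠ 0 := fun h0 => hv (dotProduct_star_self_eq_zero.1 h0)
    rw [h1, dotProduct_smul, smul_eq_mul, ← Complex.conj_eq_iff_im] at h2
    rw [← Complex.conj_eq_iff_im] at h3 hmim hcim hDim ⊢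
    rw [map_mul, map_mul, map_mul, map_mul, map_inv₀, h3, hmim, hcim, hDim] at h2
    have h5 : D * c * m⁻¹ ≠ 0 := mul_ne_zero (mul_ne_zero hGy hc0) (inv_ne_zero hm0)
    exact mul_left_cancel₀ h5 (mul_right_cancel₀ h4 h2)
  intro k
  refine map_conj_eq_self Set.finite_empty fun x _ => ?_
  let F : ℂ[X] := ∑ k : Fin (N + 1),
    C (((wr μ p).eval (y : ℂ))⁻¹ * (cof μ p k).eval (x : ℂ)) * X ^ (k : ℕ)
  have hF : F.map (starRingEnd ℂ) = F := by
    refine map_conj_eq_self (s := Set.range fun a => (μ a).re) (Set.finite_range _) fun u hu => ?_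
    rw [← hQ x u fun a ha => hu ⟨a, by simp [← ha]⟩, wr_snoc_one]
    simp only [F, eval_finsetSum, eval_mul, eval_C, eval_pow, eval_X, Finset.mul_sum, mul_assoc]
  have hcoeff : F.coeff k = ((wr μ p).eval (y : ℂ))⁻¹ * (cof μ p k).eval (x : ℂ) := by
    simp only [F, finsetSum_coeff, coeff_C_mul, coeff_X_pow, mul_ite, mul_one, mul_zero,
      Fin.val_inj]
    simp
  have h1 := congrArg (fun f => f.coeff (k : ℕ)) hF
  simp only [coeff_map, hcoeff] at h1
  rw [eval_C_mul]
  exact Complex.conj_eq_iff_im.1 h1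

theorem exists_eq_C_mul_of_mul_derivative_eq {A P : ℂ[X]} (hP : P ≠ 0)
    (h : derivative P * A = P * derivative A) : ∃ b : ℂ, A = C b * P := by
  obtain ⟨x, hx⟩ : ∃ x, P.eval x ≠ 0 := by
    by_contra! hx
    exact hP (Polynomial.funext fun x => by rw [hx, eval_zero])
  refine ⟨A.eval x / P.eval x, ?_⟩
  rw [← sub_eq_zero]
  set B := A - C (A.eval x / P.eval x) * P with hB
  by_contra hB0
  have hroot : B.IsRoot x := by
    rw [IsRoot.def, hB, eval_sub, eval_C_mul, div_mul_cancel₀ _ hx, sub_self]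
  have hBP : P * derivative B = derivative P * B := by
    rw [hB, derivative_sub, derivative_C_mul]
    linear_combination -h
  have hB' : derivative B ≠ 0 := by
    intro h0
    obtain ⟨c, hc⟩ := natDegree_eq_zero.1 (derivative_eq_zero.1 h0)
    rw [← hc, IsRoot.def, eval_C] at hroot
    exact hB0 (by rw [← hc, hroot, C_0])
  have h1 := derivative_rootMultiplicity_of_root hroot
  have h2 := (rootMultiplicity_pos hB0).2 hroot
  have h3 : (X - C x) ^ B.rootMultiplicity x ∣ derivative B := by
    refine (IsCoprime.pow_left ?_).dvd_of_dvd_mul_left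
      (hBP ▸ (pow_rootMultiplicity_dvd B x).mul_left _ :
        (X - C x) ^ B.rootMultiplicity x ∣ P * derivative B)
    exact (irreducible_X_sub_C x).coprime_iff_not_dvd.2 fun hd => hx (dvd_iff_isRoot.1 hd)
  have h4 := (le_rootMultiplicity_iff hB').2 h3
  omega

theorem eq_zero_of_mul_derivative_eq {A P : ℂ[X]} (hP : P ≠ 0) {d : ℂ} (hd : d ≠ 0)
    (h : derivative P * A = P * twist d A) : A = 0 := by
  by_contra hA
  rw [twist_apply, smul_eq_C_mul, mul_add, ← sub_eq_iff_eq_add'] at h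
  have h1 : (P * (C d * A)).degree = P.degree + A.degree := by
    rw [degree_mul, degree_C_mul hd]
  refine (lt_irrefl (P.degree + A.degree)) ?_
  nth_rw 1 [← h1]
  rw [← h]
  refine (degree_sub_le _ _).trans_lt (max_lt ?_ ?_)
  · rw [degree_mul]
    exact WithBot.add_lt_add_right (degree_ne_bot.2 hA) (degree_derivative_lt hP)
  · rw [degree_mul]
    exact WithBot.add_lt_add_left (degree_ne_bot.2 hP) (degree_derivative_lt hA)

/-- A polynomial whose product with `exp (c x)` is annihilated by the differential operator of the
given quasipolynomials is spanned by those of exponent `c`. -/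
theorem mem_span_of_wr_snoc_eq_zero (μ : Fin N → ℂ) (p : Fin N → ℂ[X]) (hP : wr μ p ≠ 0) {c : ℂ}
    {f : ℂ[X]} (hf : wr (Fin.snoc μ c : Fin (N + 1) → ℂ) (Fin.snoc p f : Fin (N + 1) → ℂ[X]) = 0) :
    f ∈ Submodule.span ℂ (p '' {a | μ a = c}) := by
  let A := (jets μ p).cramer fun k => (twist c ^ (k : ℕ)) f
  have hA : ∀ k : Fin N, ∑ a, A a * (twist (μ a) ^ (k : ℕ)) (p a) =
      wr μ p * (twist c ^ (k : ℕ)) f := by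
    intro k
    have := congrFun (Matrix.mulVec_cramer (jets μ p) fun k => (twist c ^ (k : ℕ)) f) k
    simpa [Matrix.mulVec, dotProduct, jets, mul_comm, wr, A] using this
  have hA' : ∀ k : Fin (N + 1), ∑ a, A a * (twist (μ a) ^ (k : ℕ)) (p a) =
      wr μ p * (twist c ^ (k : ℕ)) f := by
    intro k
    induction k using Fin.lastCases with
    | cast k => exact hA k
    | last =>
      apply mul_left_cancel₀ hP
      rw [wr_snoc, Fin.sum_univ_castSucc, cof_last] at hf
      have h1 := fun a => sum_cof_mul μ p a
      simp only [Fin.sum_univ_castSucc, cof_last] at h1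
      have h2 : ∑ a, A a * (∑ k : Fin N, cof μ p k.castSucc *
          (twist (μ a) ^ (k.castSucc : ℕ)) (p a) + wr μ p *
            (twist (μ a) ^ (Fin.last N : ℕ)) (p a)) = 0 :=
        Finset.sum_eq_zero fun a _ => by rw [h1, mul_zero]
      have h3 : ∑ a, A a * ∑ k : Fin N, cof μ p k.castSucc *
          (twist (μ a) ^ (k.castSucc : ℕ)) (p a) =
          wr μ p * ∑ k : Fin N, cof μ p k.castSucc * (twist c ^ (k.castSucc : ℕ)) f := by
        simp only [Finset.mul_sum]
        rw [Finset.sum_comm]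
        refine Finset.sum_congr rfl fun k _ => ?_
        simp only [Fin.val_castSucc]
        rw [← mul_left_comm, ← hA k, Finset.mul_sum]
        exact Finset.sum_congr rfl fun a _ => by ring
      simp only [mul_add, Finset.sum_add_distrib] at h2
      rw [h3] at h2
      rw [Finset.mul_sum]
      simp only [mul_left_comm (wr μ p) (A _)]
      linear_combination h2 - wr μ p * hf
  have hB : ∀ a, derivative (wr μ p) * A a = wr μ p * twist (c - μ a) (A a) := by
    have h1 : (jets μ p).mulVec
        (fun a => derivative (wr μ p) * A a - wr μ p * twist (c - μ a) (A a)) = 0 := by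
      ext1 k
      have h2 := congrArg (twist c) (hA k)
      have h3 : twist c (wr μ p * (twist c ^ (k : ℕ)) f) =
          derivative (wr μ p) * (twist c ^ (k : ℕ)) f +
            wr μ p * (twist c ^ ((k : ℕ) + 1)) f := by
        have := twist_mul 0 c (wr μ p) ((twist c ^ (k : ℕ)) f)
        rwa [zero_add, twist_apply 0, zero_smul, add_zero, ← twist_pow_succ_apply] at this
      have h4 : ∀ a, twist c (A a * (twist (μ a) ^ (k : ℕ)) (p a)) =
          twist (c - μ a) (A a) * (twist (μ a) ^ (k : ℕ)) (p a) +
            A a * (twist (μ a) ^ ((k : ℕ) + 1)) (p a) := by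
        intro a
        have := twist_mul (c - μ a) (μ a) (A a) ((twist (μ a) ^ (k : ℕ)) (p a))
        rwa [sub_add_cancel, ← twist_pow_succ_apply] at this
      have h5 := hA' k.succ
      rw [Fin.val_succ] at h5
      rw [map_sum, h3, Finset.sum_congr rfl fun a _ => h4 a, Finset.sum_add_distrib, h5] at h2
      have h6 : (jets μ p).mulVec
          (fun a => derivative (wr μ p) * A a - wr μ p * twist (c - μ a) (A a)) k =
          derivative (wr μ p) * (∑ a, A a * (twist (μ a) ^ (k : ℕ)) (p a)) -
            wr μ p * ∑ a, twist (c - μ a) (A a) * (twist (μ a) ^ (k : ℕ)) (p a) := by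
        rw [Finset.mul_sum, Finset.mul_sum, ← Finset.sum_sub_distrib]
        change ∑ a, jets μ p k a * _ = _
        refine Finset.sum_congr rfl fun a _ => ?_
        simp only [jets, Matrix.of_apply]
        ring
      rw [h6, hA k, Pi.zero_apply]
      linear_combination -(wr μ p) * h2
    intro a
    exact sub_eq_zero.1 (congrFun (Matrix.eq_zero_of_mulVec_eq_zero hP h1) a)
  have hb : ∀ a, ∃ b : ℂ, A a = C b * wr μ p ∧ (μ a ≠ c → b = 0) := by
    intro a
    by_cases h : μ a = c
    · have h1 := hB a
      rw [h, sub_self, twist_apply, zero_smul, add_zero] at h1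
      obtain ⟨b, hb⟩ := exists_eq_C_mul_of_mul_derivative_eq hP h1
      exact ⟨b, hb, fun h' => absurd h h'⟩
    · exact ⟨0, by rw [eq_zero_of_mul_derivative_eq hP (sub_ne_zero.2 (Ne.symm h)) (hB a)]; simp,
        fun _ => rfl⟩
  choose b hb hb0 using hb
  have hfsum : f = ∑ a, b a • p a := by
    apply mul_left_cancel₀ hP
    have h1 := hA' 0
    simp only [Fin.val_zero, pow_zero, Module.End.one_apply] at h1
    rw [← h1, Finset.mul_sum]
    refine Finset.sum_congr rfl fun a _ => ?_
    rw [hb, smul_eq_C_mul]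
    ring
  rw [hfsum]
  refine Submodule.sum_mem _ fun a _ => ?_
  by_cases h : μ a = c
  · exact Submodule.smul_mem _ _ (Submodule.subset_span ⟨a, h, rfl⟩)
  · rw [hb0 a h, zero_smul]
    exact Submodule.zero_mem _

theorem map_twist_pow (c : ℂ) (hc : c.im = 0) (k : ℕ) (f : ℂ[X]) :
    ((twist c ^ k) f).map (starRingEnd ℂ) = (twist c ^ k) (f.map (starRingEnd ℂ)) := by
  induction k with
  | zero => rfl
  | succ k ih =>
    rw [twist_pow_succ_apply, twist_pow_succ_apply, ← ih, twist_apply, twist_apply,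
      Polynomial.map_add, derivative_map, smul_eq_C_mul, Polynomial.map_mul, map_C,
      Complex.conj_eq_iff_im.2 hc, smul_eq_C_mul]

theorem wr_snoc_eq_zero_of_mem_span (μ : Fin N → ℂ) (p : Fin N → ℂ[X]) {c : ℂ} {f : ℂ[X]}
    (hf : f ∈ Submodule.span ℂ (p '' {a | μ a = c})) :
    wr (Fin.snoc μ c : Fin (N + 1) → ℂ) (Fin.snoc p f : Fin (N + 1) → ℂ[X]) = 0 := by
  rw [wr_snoc]
  induction hf using Submodule.span_induction with
  | mem f hf =>
    obtain ⟨a, rfl, rfl⟩ := hf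
    exact sum_cof_mul μ p a
  | zero => simp
  | add f g _ _ hf hg => simp only [map_add, mul_add, Finset.sum_add_distrib, hf, hg, add_zero]
  | smul b f _ hf => simp only [map_smul, mul_smul_comm, ← Finset.smul_sum, hf, smul_zero]

/-- The spaces of quasipolynomials with real exponents and real-rooted Wronskian are stable under
complex conjugation. -/
theorem map_conj_mem_span (μ : Fin N → ℂ) (p : Fin N → ℂ[X]) (hμ : ∀ a, (μ a).im = 0)
    (hP : wr μ p ≠ 0) (hroots : ∀ z, (wr μ p).IsRoot z → z.im = 0) {c : ℂ} (hc : c.im = 0)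
    {f : ℂ[X]} (hf : f ∈ Submodule.span ℂ (p '' {a | μ a = c})) :
    f.map (starRingEnd ℂ) ∈ Submodule.span ℂ (p '' {a | μ a = c}) := by
  obtain ⟨κ, hκ, hcof⟩ := exists_map_conj_C_mul_cof μ p hμ hP hroots
  apply mem_span_of_wr_snoc_eq_zero μ p hP
  have h1 := wr_snoc_eq_zero_of_mem_span μ p hf
  rw [wr_snoc] at h1 ⊢
  apply mul_left_cancel₀ (C_ne_zero.2 hκ)
  have h2 := congrArg (fun g => (C κ * g).map (starRingEnd ℂ)) h1
  simp only [Finset.mul_sum, Polynomial.map_sum, mul_zero, Polynomial.map_zero] at h2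
  rw [Finset.mul_sum, mul_zero, ← h2]
  refine Finset.sum_congr rfl fun k _ => ?_
  rw [← mul_assoc, ← mul_assoc, Polynomial.map_mul, hcof, map_twist_pow c hc]

theorem iteratedDeriv_sum_exp_mul_eval {ι : Type*} [Fintype ι] (μ : ι → ℂ) (f : ι → ℂ[X])
    (k : ℕ) : (iteratedDeriv k fun x : ℝ => ∑ j, Complex.exp (μ j * (x : ℂ)) * (f j).eval (x : ℂ)) =
      fun x : ℝ => ∑ j, Complex.exp (μ j * (x : ℂ)) * ((twist (μ j) ^ k) (f j)).eval (x : ℂ) := by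
  induction k with
  | zero => simp
  | succ k ih =>
    rw [iteratedDeriv_succ, ih]
    ext1 x
    refine (HasDerivAt.fun_sum fun j _ => ?_).deriv
    have h1 : HasDerivAt (fun x : ℝ => Complex.exp (μ j * (x : ℂ)))
        (Complex.exp (μ j * (x : ℂ)) * μ j) x := by
      have := ((hasDerivAt_id (x : ℂ)).const_mul (μ j)).cexp.comp_ofReal
      simpa using this
    have h2 := (((twist (μ j) ^ k) (f j)).hasDerivAt (x : ℂ)).comp_ofReal
    refine (h1.mul h2).congr_deriv ?_
    rw [twist_pow_succ_apply, twist_apply, eval_add, eval_smul, smul_eq_mul]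
    ring

theorem exists_real_spanning_set {W : Submodule ℂ ℂ[X]}
    (hW : ∀ f ∈ W, f.map (starRingEnd ℂ) ∈ W) :
    ∃ S : Set ℂ[X], (∀ r ∈ S, ∀ m, (r.coeff m).im = 0) ∧ Submodule.span ℂ S = W := by
  refine ⟨{r | r ∈ W ∧ ∀ m, (r.coeff m).im = 0}, fun r hr => hr.2,
    le_antisymm (Submodule.span_le.2 fun r hr => hr.1) fun f hf => ?_⟩
  have h1 : f + f.map (starRingEnd ℂ) ∈ {r | r ∈ W ∧ ∀ m, (r.coeff m).im = 0} :=
    ⟨W.add_mem hf (hW f hf), fun m => by simp [coeff_map]⟩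
  have h2 : Complex.I • (f - f.map (starRingEnd ℂ)) ∈ {r | r ∈ W ∧ ∀ m, (r.coeff m).im = 0} :=
    ⟨W.smul_mem _ (W.sub_mem hf (hW f hf)), fun m => by simp [coeff_map]⟩
  have h3 : f = (1 / 2 : ℂ) • (f + f.map (starRingEnd ℂ)) +
      (-Complex.I / 2) • Complex.I • (f - f.map (starRingEnd ℂ)) := by
    ext m
    simp only [coeff_add, coeff_smul, coeff_sub, smul_eq_mul]
    linear_combination (1 / 2 : ℂ) * (f.coeff m - (f.map (starRingEnd ℂ)).coeff m) * Complex.I_sq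
  rw [h3]
  exact Submodule.add_mem _ (Submodule.smul_mem _ _ (Submodule.subset_span h1))
    (Submodule.smul_mem _ _ (Submodule.subset_span h2))

end QuasiWronskian

end

/-- **Mukhin–Tarasov–Varchenko, quasipolynomial version.** Let `μ₁, …, μ_k` be
distinct real numbers, `V₁, …, V_k` nonzero finite-dimensional subspaces of `ℂ[x]`,
`N = ∑ dim V_j`, and `q₁, …, q_N` a basis of the space of quasipolynomials
`⊕_j e^{μ_j x} V_j` (as functions `ℝ → ℂ`). If the Wronskian `Wr(q₁, …, q_N)` equals
`e^{(∑_j dim V_j · μ_j) x} · P(x)` for a nonzero polynomial `P` all of whose complex roots are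
real, then each `V_j` is spanned by polynomials with real coefficients. -/
theorem quasipolynomials_real_bases (k : ℕ) (μ : Fin k → ℝ) (hμ : Function.Injective μ)
    (V : Fin k → Submodule ℂ (Polynomial ℂ))
    (hVfin : ∀ j, FiniteDimensional ℂ (V j))
    (hVne : ∀ j, V j ≠ ⊥)
    (N : ℕ) (hN : N = ∑ j, Module.finrank ℂ (V j))
    (q : Fin N → (ℝ → ℂ))
    (hqmem : ∀ i, ∃ p : (j : Fin k) → Polynomial ℂ, (∀ j, p j ∈ V j) ∧
      q i = fun x : ℝ => ∑ j, Complex.exp ((μ j : ℂ) * (x : ℂ)) * (p j).eval (x : ℂ))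
    (hqind : LinearIndependent ℂ q)
    (hqspan : ∀ p : (j : Fin k) → Polynomial ℂ, (∀ j, p j ∈ V j) →
      (fun x : ℝ => ∑ j, Complex.exp ((μ j : ℂ) * (x : ℂ)) * (p j).eval (x : ℂ)) ∈
        Submodule.span ℂ (Set.range q))
    (P : Polynomial ℂ) (hP0 : P ≠ 0)
    (hProots : ∀ z : ℂ, P.IsRoot z → z.im = 0)
    (hWr : ∀ x : ℝ,
      (Matrix.of fun i j : Fin N => iteratedDeriv (i : ℕ) (q j) x).det =
        Complex.exp ((∑ j, (Module.finrank ℂ (V j) : ℂ) * (μ j : ℂ)) * (x : ℂ)) *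
          P.eval (x : ℂ)) :
    ∀ j, ∃ S : Set (Polynomial ℂ),
      (∀ r ∈ S, ∀ m, (r.coeff m).im = 0) ∧ Submodule.span ℂ S = V j := by
  classical
  subst hN
  let b := fun j => Module.finBasis ℂ (V j)
  let e := finSigmaFinEquiv (n := fun j => Module.finrank ℂ (V j))
  let m : Fin (∑ j, Module.finrank ℂ (V j)) → ℂ := fun a => (μ (e.symm a).1 : ℂ)
  let p : Fin (∑ j, Module.finrank ℂ (V j)) → Polynomial ℂ :=
    fun a => (b (e.symm a).1 (e.symm a).2 : Polynomial ℂ)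
  have hp : ∀ i l, p (e ⟨i, l⟩) = (b i l : Polynomial ℂ) := by
    intro i l
    simp only [p]
    rw [e.symm_apply_apply]
  have hspan : ∀ j, Submodule.span ℂ (p '' {a | m a = μ j}) = V j := by
    intro j
    have h1 : p '' {a | m a = μ j} = (V j).subtype '' Set.range (b j) := by
      ext f
      constructor
      · rintro ⟨a, ha, rfl⟩
        obtain ⟨⟨i, l⟩, rfl⟩ := e.surjective a
        simp only [m, Set.mem_ofPred_eq, Equiv.symm_apply_apply, Complex.ofReal_inj] at ha
        obtain rfl := hμ ha
        exact ⟨b i l, ⟨l, rfl⟩, (hp i l).symm⟩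
      · rintro ⟨_, ⟨l, rfl⟩, rfl⟩
        exact ⟨e ⟨j, l⟩, by simp [m], hp j l⟩
    rw [h1, Submodule.span_image, (b j).span_eq, Submodule.map_subtype_top]
  choose f hf hqf using hqmem
  let D : Matrix (Fin (∑ j, Module.finrank ℂ (V j))) (Fin (∑ j, Module.finrank ℂ (V j))) ℂ :=
    Matrix.of fun a i => (b (e.symm a).1).repr ⟨f i (e.symm a).1, hf i _⟩ (e.symm a).2
  have hfactor : ∀ x : ℝ,
      (Matrix.of fun i j => iteratedDeriv (i : ℕ) (q j) x :
        Matrix (Fin (∑ j, Module.finrank ℂ (V j))) (Fin (∑ j, Module.finrank ℂ (V j))) ℂ) =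
      (Matrix.of fun i a => Complex.exp (m a * x) *
        (QuasiWronskian.jets m p).map (Polynomial.evalRingHom (x : ℂ)) i a) * D := by
    intro x
    ext i j
    have h1 : ∀ l, f j l = ∑ c, (b l).repr ⟨f j l, hf j l⟩ c • (b l c : Polynomial ℂ) := by
      intro l
      have := congrArg (V l).subtype ((b l).sum_repr ⟨f j l, hf j l⟩)
      rw [map_sum] at this
      simpa only [map_smul, Submodule.subtype_apply] using this.symm
    rw [Matrix.mul_apply, Matrix.of_apply, hqf,
      QuasiWronskian.iteratedDeriv_sum_exp_mul_eval (fun j => (μ j : ℂ)), ← e.sum_comp,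
      Fintype.sum_sigma]
    refine Finset.sum_congr rfl fun l _ => ?_
    nth_rw 1 [h1 l]
    rw [map_sum, Polynomial.eval_finsetSum, Finset.mul_sum]
    refine Finset.sum_congr rfl fun c _ => ?_
    simp only [D, m, p, QuasiWronskian.jets, Matrix.of_apply, Matrix.map_apply, map_smul,
      Polynomial.eval_smul, smul_eq_mul, Polynomial.coe_evalRingHom]
    rw [e.symm_apply_apply]
    ring
  have hsum : ∑ a, m a = ∑ j, (Module.finrank ℂ (V j) : ℂ) * (μ j : ℂ) := by
    rw [← e.sum_comp, Fintype.sum_sigma]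
    simp [m]
  have hPw : P = Polynomial.C D.det * QuasiWronskian.wr m p := by
    refine QuasiWronskian.eq_of_eval_ofReal_eq Set.finite_empty fun x _ => ?_
    have h1 := hWr x
    rw [hfactor x, Matrix.det_mul, Matrix.det_mul_row, ← Complex.exp_sum, ← Finset.sum_mul, hsum,
      ← RingHom.mapMatrix_apply, ← RingHom.map_det, mul_assoc] at h1
    rw [← mul_left_cancel₀ (Complex.exp_ne_zero _) h1, Polynomial.eval_C_mul, mul_comm]
    rfl
  have hw0 : QuasiWronskian.wr m p ≠ 0 := by
    intro h
    rw [hPw, h, mul_zero] at hP0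
    exact hP0 rfl
  have hroots : ∀ z, (QuasiWronskian.wr m p).IsRoot z → z.im = 0 := fun z hz => hProots z <| by
    rw [hPw, Polynomial.IsRoot.def, Polynomial.eval_C_mul, hz.eq_zero, mul_zero]
  intro j
  refine QuasiWronskian.exists_real_spanning_set fun g hg => ?_
  rw [← hspan j] at hg ⊢
  exact QuasiWronskian.map_conj_mem_span m p (fun a => Complex.ofReal_im _) hw0 hroots
    (Complex.ofReal_im _) hg
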